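/- arXiv:2404.13942 — 2 statements merged into one kernel-verified Lean document; each statement's English description precedes it below -/
import Mathlib

section
/- (Duminil-Copin–Smirnov) The connective constant of the hexagonal lattice equals √(2+√2): for the brick lattice H, lim_{n→∞} σ_n(H)^{1/n} = √(2+√2). -/
open Filter Topology

/-- Adjacency in the brick lattice `H` (a graph isomorphic to the hexagonal lattice):
vertices are the points of `ℤ²`; there is an edge between `(x, y)` and `(x+1, y)` for all
`(x, y)`, and an edge between `(x, y)` and `(x, y+1)` whenever `x + y` is even. -/
def BrickAdj (u v : ℤ × ℤ) : Prop :=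
  (u.2 = v.2 ∧ (v.1 = u.1 + 1 ∨ u.1 = v.1 + 1)) ∨
  (u.1 = v.1 ∧ ((v.2 = u.2 + 1 ∧ Even (u.1 + u.2)) ∨ (u.2 = v.2 + 1 ∧ Even (v.1 + v.2))))

/-- `ω` is an `n`-step self-avoiding walk on the brick lattice `H`, started at the origin. -/
def IsBrickSAW (n : ℕ) (ω : Fin (n + 1) → ℤ × ℤ) : Prop :=
  ω 0 = (0, 0) ∧
  (∀ i : Fin n, BrickAdj (ω i.castSucc) (ω i.succ)) ∧
  Function.Injective ω

/-- `brickSawCount n = σ_n(H)`, the number of `n`-step self-avoiding walks on `H`. -/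
noncomputable def brickSawCount (n : ℕ) : ℕ :=
  Set.ncard {ω : Fin (n + 1) → ℤ × ℤ | IsBrickSAW n ω}

namespace BrickLattice

open scoped ENNReal

/-- The vertical neighbour of a vertex of the brick lattice. -/
def vert (u : ℤ × ℤ) : ℤ × ℤ := if Even (u.1 + u.2) then (u.1, u.2 + 1) else (u.1, u.2 - 1)

/-- The three neighbours of a vertex of the brick lattice. -/
def nbrs (u : ℤ × ℤ) : Finset (ℤ × ℤ) := {(u.1 + 1, u.2), (u.1 - 1, u.2), vert u}

theorem mem_nbrs {u v : ℤ × ℤ} : v ∈ nbrs u ↔ BrickAdj u v := by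
  obtain ⟨a, b⟩ := u
  obtain ⟨c, d⟩ := v
  simp only [nbrs, vert, BrickAdj, Finset.mem_insert, Finset.mem_singleton, Int.even_iff]
  split_ifs <;> simp only [Prod.mk.injEq] <;> omega

theorem adj_symm {u v : ℤ × ℤ} (h : BrickAdj u v) : BrickAdj v u := by
  simp only [BrickAdj, Int.even_iff] at *
  omega

/-- Signed crossing of the positive horizontal half-axis by a step from `u` to `v`. -/
def cross (u v : ℤ × ℤ) : ℤ :=
  if 0 < u.1 then (if 0 ≤ v.2 then 1 else 0) - (if 0 ≤ u.2 then 1 else 0) else 0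

theorem cross_parallelogram {z z' b b' : ℤ × ℤ} (hz : BrickAdj z z') (hb : BrickAdj b b')
    (h1 : z ≠ b) (h2 : z ≠ b') (h3 : z' ≠ b) (h4 : z' ≠ b') :
    cross (z - b) (z - b') + cross (z - b') (z' - b') =
      cross (z - b) (z' - b) + cross (z' - b) (z' - b') := by
  simp only [BrickAdj, cross, Prod.fst_sub, Prod.snd_sub, ne_eq, Prod.ext_iff] at *
  omega

/-- A self-avoiding walk, listed from its last vertex to its first. -/
def IsSAW (l : List (ℤ × ℤ)) : Prop := l.IsChain BrickAdj ∧ l.Nodup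

/-- A self-avoiding walk starting with the step from the origin to `(0, 1)` and staying in `D`
after the origin. -/
def IsArc (D : ℤ × ℤ → Prop) (l : List (ℤ × ℤ)) : Prop :=
  [(0, 1), (0, 0)] <:+ l ∧ IsSAW l ∧ ∀ v ∈ l, v ≠ (0, 0) → D v

/-- The open upper half-plane. -/
def Upper (v : ℤ × ℤ) : Prop := 1 ≤ v.2

/-- The direction of the edge from `t` to `u` in the hexagonal lattice, relative to the upward
direction and in units of sixty degrees. -/
def heading (t u : ℤ × ℤ) : ℤ :=
  if t.2 < u.2 then 0
  else if u.2 < t.2 then 3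
  else if t.1 < u.1 then (if (t.1 + t.2) % 2 = 0 then -2 else -1)
  else (if (t.1 + t.2) % 2 = 0 then 2 else 1)

/-- The turn made by a walk passing through `t`, `u`, `w`, in units of sixty degrees. -/
def turn (t u w : ℤ × ℤ) : ℤ :=
  heading u w - heading t u + 6 * cross (u - t) (w - t) + 6 * cross (w - t) (w - u)

/-- Crossings made by the vector pointing to `z` from a point following a walk. -/
def crossings (z : ℤ × ℤ) : List (ℤ × ℤ) → ℤ
  | b :: b' :: l => cross (z - b') (z - b) + crossings z (b' :: l)
  | _ => 0

/-- The winding of a walk, in units of sixty degrees, relative to the upward direction. -/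
def winding : List (ℤ × ℤ) → ℤ
  | w :: u :: t :: l => winding (u :: t :: l) + turn t u w
  | [u, t] => heading t u
  | _ => 0

theorem crossings_append (z a b : ℤ × ℤ) (l₁ l₂ : List (ℤ × ℤ)) :
    crossings z (a :: l₁ ++ b :: l₂) = crossings z (a :: l₁) +
      cross (z - b) (z - (a :: l₁).getLast (List.cons_ne_nil _ _)) + crossings z (b :: l₂) := by
  induction l₁ generalizing a with
  | nil => simp [crossings]
  | cons c l ih =>
    have := ih c
    rw [List.getLast_cons_cons]
    simp only [List.cons_append, crossings] at *
    rw [this]; ring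

theorem crossings_move {z z' : ℤ × ℤ} (hz : BrickAdj z z') (b : ℤ × ℤ) (l : List (ℤ × ℤ))
    (hc : (b :: l).IsChain BrickAdj) (h : z ∉ b :: l) (h' : z' ∉ b :: l) :
    crossings z (b :: l) + cross (z - b) (z' - b) =
      cross (z - (b :: l).getLast (List.cons_ne_nil _ _))
        (z' - (b :: l).getLast (List.cons_ne_nil _ _)) + crossings z' (b :: l) := by
  induction l generalizing b with
  | nil => simp [crossings]
  | cons d l ih =>
    rw [List.isChain_cons_cons] at hc
    have := ih d hc.2 (fun hh => h (List.mem_cons_of_mem _ hh))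
      (fun hh => h' (List.mem_cons_of_mem _ hh))
    rw [List.getLast_cons_cons]
    simp only [crossings]
    simp only [List.mem_cons, not_or] at h h'
    have := cross_parallelogram hz (adj_symm hc.1) h.2.1 h.1 h'.2.1 h'.1
    linarith

theorem cross_eq_zero_of_neg {u v : ℤ × ℤ} (hu : u.2 < 0) (hv : v.2 < 0) : cross u v = 0 := by
  simp [cross, hu.not_ge, hv.not_ge]

theorem cross_eq_zero_of_nonneg {u v : ℤ × ℤ} (hu : 0 ≤ u.2) (hv : 0 ≤ v.2) :
    cross u v = 0 := by
  simp [cross, hu, hv]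

theorem crossings_eq_zero_of_below {z : ℤ × ℤ} (l : List (ℤ × ℤ)) (h : ∀ b ∈ l, z.2 < b.2) :
    crossings z l = 0 := by
  induction l with
  | nil => rfl
  | cons b l ih =>
    cases l with
    | nil => rfl
    | cons c l =>
      simp only [List.mem_cons, forall_eq_or_imp] at h
      simp only [crossings]
      rw [ih (by simpa using h.2), cross_eq_zero_of_neg] <;> simp <;> omega

/-- A closed walk that is avoided by a walk coming from below has winding number zero around
every vertex of that walk. -/
theorem crossings_loop_eq_zero (v : ℤ × ℤ) (m : List (ℤ × ℤ))
    (hm : (v :: m ++ [v]).IsChain BrickAdj) (hpos : ∀ b ∈ v :: m ++ [v], 0 < b.2)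
    (p : ℤ × ℤ) (l : List (ℤ × ℤ)) (hl : (p :: l).IsChain BrickAdj)
    (hlast : (p :: l).getLast (List.cons_ne_nil _ _) = (0, 0))
    (hd : ∀ z ∈ p :: l, z ∉ v :: m ++ [v]) :
    crossings p (v :: m ++ [v]) = 0 := by
  induction l generalizing p with
  | nil =>
    simp only [List.getLast_singleton] at hlast
    subst hlast
    exact crossings_eq_zero_of_below _ (by simpa using hpos)
  | cons d l ih =>
    rw [List.isChain_cons_cons] at hl
    rw [List.getLast_cons_cons] at hlast
    have h1 := ih d hl.2 hlast (fun z hz => hd z (List.mem_cons_of_mem _ hz))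
    have h2 := crossings_move hl.1 v (m ++ [v]) hm (hd p (by simp)) (hd d (by simp))
    simp only [← List.cons_append, List.getLast_append_singleton] at h2
    linarith

theorem getLast_of_suffix {l : List (ℤ × ℤ)} (h : [(0, 1), (0, 0)] <:+ l) (hn : l ≠ []) :
    l.getLast hn = (0, 0) := by
  obtain ⟨m, rfl⟩ := h
  simp

theorem suffix_tail {l : List (ℤ × ℤ)} {w u t : ℤ × ℤ}
    (h : [(0, 1), (0, 0)] <:+ w :: u :: t :: l) :
    [((0 : ℤ), (1 : ℤ)), (0, 0)] <:+ u :: t :: l := by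
  rcases List.suffix_cons_iff.1 h with h | h
  · simp at h
  · exact h

theorem IsArc.tail {D : ℤ × ℤ → Prop} {l : List (ℤ × ℤ)} {w u t : ℤ × ℤ}
    (h : IsArc D (w :: u :: t :: l)) : IsArc D (u :: t :: l) :=
  ⟨suffix_tail h.1, ⟨h.2.1.1.tail, h.2.1.2.tail⟩, fun v hv => h.2.2 v (List.mem_cons_of_mem _ hv)⟩

theorem heading_extend {t u w : ℤ × ℤ} {l : List (ℤ × ℤ)} (h : IsArc Upper (u :: t :: l))
    (hw : BrickAdj u w) (hw0 : 0 ≤ w.2) (hwl : w ∉ u :: t :: l) :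
    heading u w + 6 * crossings w (u :: t :: l) =
      heading t u + 6 * crossings u (t :: l) + turn t u w := by
  have hlast := getLast_of_suffix h.1 (List.cons_ne_nil _ _)
  rw [List.getLast_cons_cons] at hlast
  have hu : u ∉ t :: l := (List.nodup_cons.1 h.2.1.2).1
  have h1 := crossings_move hw t l h.2.1.1.tail hu (fun hh => hwl (List.mem_cons_of_mem _ hh))
  rw [hlast] at h1
  have hu0 : 0 ≤ u.2 := by
    by_cases h0 : u = (0, 0)
    · simp [h0]
    · have := h.2.2 u (by simp) h0
      simp only [Upper] at this
      omega
  rw [cross_eq_zero_of_nonneg (u := u - (0, 0)) (by simpa) (by simpa)] at h1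
  simp only [crossings, turn]
  linarith

theorem winding_eq {t u : ℤ × ℤ} {l : List (ℤ × ℤ)} (h : IsArc Upper (u :: t :: l)) :
    winding (u :: t :: l) = heading t u + 6 * crossings u (t :: l) := by
  induction l generalizing t u with
  | nil => simp [winding, crossings]
  | cons s l ih =>
    have h0 : u ∉ t :: s :: l := (List.nodup_cons.1 h.2.1.2).1
    have hne : u ≠ (0, 0) := by
      rintro rfl
      have := getLast_of_suffix h.1 (List.cons_ne_nil _ _)
      rw [List.getLast_cons_cons] at this
      exact h0 (this ▸ List.getLast_mem _)
    have hu := h.2.2 u (by simp) hne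
    simp only [Upper] at hu
    rw [winding, ih h.tail, ← heading_extend h.tail
      (adj_symm (List.isChain_cons_cons.1 h.2.1.1).1) (by omega) h0]

theorem turn_loop {v p q r : ℤ × ℤ} (hp : BrickAdj v p) (hq : BrickAdj v q) (hr : BrickAdj v r)
    (hpq : p ≠ q) (hpr : p ≠ r) (hqr : q ≠ r) :
    heading r v - heading p v + 6 * (-cross (p - r) (p - v) - cross (p - v) (p - q)
      - cross (v - r) (p - r) + cross (v - q) (p - q) + cross (r - q) (v - q)
      + cross (r - v) (r - q) + cross (r - p) (r - v) + cross (v - p) (r - p)) =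
    -4 * turn p v q := by
  obtain ⟨x, y⟩ := v
  rw [← mem_nbrs] at hp hq hr
  simp only [nbrs, vert, Finset.mem_insert, Finset.mem_singleton] at hp hq hr
  rcases Int.even_or_odd (x + y) with h | h
  all_goals
    try rw [← Int.not_even_iff_odd] at h
    simp only [h, if_true, if_false] at hp hq hr
    rw [Int.even_iff] at h
    rcases hp with rfl | rfl | rfl
    all_goals
      rcases hq with rfl | rfl | rfl
      all_goals
        first
        | exact absurd rfl hpq
        | rcases hr with rfl | rfl | rfl
          all_goals
            first
            | exact absurd rfl hpr
            | exact absurd rfl hqr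
            | simp only [turn, heading, cross, Prod.fst_sub, Prod.snd_sub]
              omega

theorem winding_loop {v p r t : ℤ × ℤ} {m l : List (ℤ × ℤ)}
    (h : IsArc Upper ((r :: t :: m) ++ v :: p :: l)) (hv : Upper v) (hrv : BrickAdj r v) :
    winding (v :: (r :: t :: m) ++ v :: p :: l) =
      winding (v :: p :: l) - 4 * turn p v ((t :: m).getLast (List.cons_ne_nil _ _)) := by
  set q := (t :: m).getLast (List.cons_ne_nil _ _) with hq
  have hsuf : [((0 : ℤ), (1 : ℤ)), (0, 0)] <:+ v :: p :: l := by
    rcases List.suffix_or_suffix_of_suffix h.1 (List.suffix_append (r :: t :: m) (v :: p :: l))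
      with h' | h'
    · exact h'
    · rw [h'.eq_of_length_le (by simp)]
  have hlast := getLast_of_suffix hsuf (List.cons_ne_nil _ _)
  rw [List.getLast_cons_cons] at hlast
  obtain ⟨-, ⟨hch, hnd⟩, hD⟩ := id h
  rw [List.isChain_append] at hch
  rw [List.nodup_append] at hnd
  obtain ⟨hc1, hc2, hc3⟩ := hch
  obtain ⟨hn1, hn2, hn3⟩ := hnd
  have hqm : q ∈ r :: t :: m := List.mem_cons_of_mem _ (List.getLast_mem _)
  have hqv : BrickAdj q v := by
    apply hc3 q _ v (by simp)
    rw [List.getLast?_eq_getLast_of_ne_nil (List.cons_ne_nil _ _)]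
    simp [hq]
  have harc : IsArc Upper (v :: p :: l) :=
    ⟨hsuf, ⟨hc2, hn2⟩, fun z hz => h.2.2 z (List.mem_append_right _ hz)⟩
  have hpos : ∀ z ∈ r :: t :: m, 0 < z.2 := by
    intro z hz
    have h0 : z ≠ (0, 0) := by
      rintro rfl
      exact hn3 _ hz (0, 0) (List.mem_cons_of_mem _ (hlast ▸ List.getLast_mem _)) rfl
    have := h.2.2 z (List.mem_append_left _ hz) h0
    simp only [Upper] at this
    omega
  have hdis : ∀ z ∈ p :: l, z ∉ r :: t :: m :=
    fun z hz hz' => hn3 z hz' z (List.mem_cons_of_mem _ hz) rfl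
  have hvm : v ∉ r :: t :: m := fun hz => hn3 v hz v (by simp) rfl
  have hvl : v ∉ p :: l := (List.nodup_cons.1 hn2).1
  have hpm : p ∉ r :: t :: m := hdis p (by simp)
  have hrm : r ∉ t :: m := (List.nodup_cons.1 hn1).1
  have hrl : r ∉ p :: l := fun hz => hdis r hz (by simp)
  have hvp : BrickAdj v p := (List.isChain_cons_cons.1 hc2).1
  have hloop : crossings p (v :: (r :: t :: m) ++ [v]) = 0 := by
    apply crossings_loop_eq_zero _ _ _ _ p l hc2.tail hlast
    · intro z hz hz'
      simp only [List.cons_append, List.mem_cons, List.mem_append, List.not_mem_nil,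
        or_false] at hz'
      have h1 := hdis z hz
      simp only [List.mem_cons] at h1
      have h2 : z ≠ v := fun e => hvl (e ▸ hz)
      tauto
    · rw [List.cons_append, List.cons_append, List.isChain_cons_cons, ← List.cons_append,
        List.isChain_append]
      refine ⟨adj_symm hrv, hc1, by simp, ?_⟩
      intro x hx y hy
      exact hc3 x hx y (by simpa using hy)
    · intro z hz
      simp only [Upper] at hv
      simp only [List.cons_append, List.mem_cons, List.mem_append, List.not_mem_nil,
        or_false] at hz
      have h1 := hpos z
      simp only [List.mem_cons] at h1
      by_cases h2 : z = v
      · subst h2; omega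
      · exact h1 (by tauto)
  have hlq : (r :: t :: m).getLast (List.cons_ne_nil _ _) = q := by
    rw [List.getLast_cons_cons]
  have e1 := crossings_append p v v (r :: t :: m) []
  rw [hloop, List.getLast_cons_cons, hlq] at e1
  have e2 := crossings_move hvp r (t :: m) hc1 hvm hpm
  have e3 := crossings_append r t v m (p :: l)
  have e4 := crossings_move (adj_symm hrv) p l hc2.tail hvl hrl
  have e5 := crossings_move hrv t m hc1.tail hrm (fun hz => hvm (List.mem_cons_of_mem _ hz))
  rw [hlq] at e2
  rw [← hq] at e3 e5
  rw [hlast, cross_eq_zero_of_nonneg (u := v - (0, 0))] at e4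
  · have e6 : winding (r :: t :: (m ++ v :: p :: l)) =
        heading t r + 6 * crossings r (t :: (m ++ v :: p :: l)) := winding_eq h
    have e7 := winding_eq harc
    have e8 := turn_loop hvp (adj_symm hqv) (adj_symm hrv) (fun e => hpm (e ▸ hqm))
      (fun e => hpm (e ▸ List.mem_cons_self))
      (fun e => hrm (e ▸ List.getLast_mem (List.cons_ne_nil t m)))
    simp only [List.cons_append, winding, crossings] at *
    simp only [turn] at *
    linarith
  · simp only [Upper] at hv
    simp; omega
  · have := hpos r (by simp)
    simpa using this.le

theorem turn_cases {t u w₁ w₂ : ℤ × ℤ} (ht : BrickAdj u t) (h1 : BrickAdj u w₁)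
    (h2 : BrickAdj u w₂) (ht1 : t ≠ w₁) (ht2 : t ≠ w₂) (h12 : w₁ ≠ w₂) :
    (turn t u w₁ = 1 ∧ turn t u w₂ = -1) ∨ (turn t u w₁ = -1 ∧ turn t u w₂ = 1) := by
  obtain ⟨x, y⟩ := u
  rw [← mem_nbrs] at ht h1 h2
  simp only [nbrs, vert, Finset.mem_insert, Finset.mem_singleton] at ht h1 h2
  rcases Int.even_or_odd (x + y) with h | h
  all_goals
    try rw [← Int.not_even_iff_odd] at h
    simp only [h, if_true, if_false] at ht h1 h2
    rw [Int.even_iff] at h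
    rcases ht with rfl | rfl | rfl
    all_goals
      rcases h1 with rfl | rfl | rfl
      all_goals
        first
        | exact absurd rfl ht1
        | rcases h2 with rfl | rfl | rfl
          all_goals
            first
            | exact absurd rfl ht2
            | exact absurd rfl h12
            | simp only [turn, heading, cross, Prod.fst_sub, Prod.snd_sub]
              omega

theorem card_nbrs (u : ℤ × ℤ) : (nbrs u).card = 3 := by
  have hv : (vert u).2 ≠ u.2 := by unfold vert; split_ifs <;> simp
  unfold nbrs
  rw [Finset.card_insert_of_notMem, Finset.card_pair]
  · intro h; exact hv (by rw [← h])
  · simp only [Finset.mem_insert, Finset.mem_singleton, Prod.mk.injEq, not_or]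
    refine ⟨by omega, fun h => hv (by rw [← h])⟩

/-- The possible continuations, without backtracking, of a walk with at least one step. -/
def nexts : List (ℤ × ℤ) → Finset (ℤ × ℤ)
  | u :: t :: _ => (nbrs u).erase t
  | _ => ∅

/-- The critical weight per vertex. -/
noncomputable def xc : ℝ := (2 * Real.cos (Real.pi / 8))⁻¹

/-- The real part of the phase attached to a walk with winding `k`. -/
noncomputable def phase (k : ℤ) : ℝ := Real.cos (k * (Real.pi / 8))

theorem cos_pi_div_eight_pos : 0 < Real.cos (Real.pi / 8) :=
  Real.cos_pos_of_mem_Ioo ⟨by linarith [Real.pi_pos], by linarith [Real.pi_pos]⟩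

theorem xc_pos : 0 < xc := inv_pos.2 (mul_pos two_pos cos_pi_div_eight_pos)

theorem phase_add_phase (k : ℤ) : phase k = xc * (phase (k + 1) + phase (k + -1)) := by
  have : phase (k + 1) + phase (k + -1) = 2 * Real.cos (Real.pi / 8) * phase k := by
    simp only [phase]
    push_cast
    rw [add_mul, add_mul, Real.cos_add, Real.cos_add]
    simp only [one_mul, neg_mul, Real.cos_neg, Real.sin_neg]
    ring
  rw [this, xc, inv_mul_cancel_left₀ (mul_pos two_pos cos_pi_div_eight_pos).ne']

theorem phase_add_four (k : ℤ) : phase (k + 4) = -phase (k - 4) := by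
  simp only [phase]
  push_cast
  rw [add_mul, sub_mul, show (4 : ℝ) * (Real.pi / 8) = Real.pi / 2 by ring, Real.cos_add_pi_div_two,
    Real.cos_sub_pi_div_two]

theorem phase_eq_sum {u t : ℤ × ℤ} (h : BrickAdj u t) (l : List (ℤ × ℤ)) :
    phase (winding (u :: t :: l)) =
      xc * ∑ w ∈ nexts (u :: t :: l), phase (winding (w :: u :: t :: l)) := by
  have hc : ((nbrs u).erase t).card = 2 := by
    rw [Finset.card_erase_of_mem (mem_nbrs.2 h), card_nbrs]
  obtain ⟨w₁, w₂, h12, he⟩ := Finset.card_eq_two.1 hc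
  have h1 : w₁ ∈ (nbrs u).erase t := by simp [he]
  have h2 : w₂ ∈ (nbrs u).erase t := by simp [he]
  rw [Finset.mem_erase, mem_nbrs] at h1 h2
  simp only [nexts, he, Finset.sum_pair h12, winding]
  rcases turn_cases h h1.2 h2.2 h1.1.symm h2.1.symm h12 with ⟨e1, e2⟩ | ⟨e1, e2⟩ <;> rw [e1, e2]
  · exact phase_add_phase _
  · rw [add_comm (phase _)]; exact phase_add_phase _

open Classical in
/-- The arcs in `D` with `n` steps after the first one. -/
noncomputable def arcs (D : ℤ × ℤ → Prop) : ℕ → Finset (List (ℤ × ℤ))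
  | 0 => {[(0, 1), (0, 0)]}
  | n + 1 => (((arcs D n).sigma nexts).filter (fun p => D p.2 ∧ p.2 ∉ p.1)).image
      fun p => p.2 :: p.1

theorem mem_arcs {D : ℤ × ℤ → Prop} (hs : D (0, 1)) {n : ℕ} {l : List (ℤ × ℤ)} :
    l ∈ arcs D n ↔ IsArc D l ∧ l.length = n + 2 := by
  induction n generalizing l with
  | zero =>
    simp only [arcs, Finset.mem_singleton]
    constructor
    · rintro rfl
      refine ⟨⟨List.suffix_rfl, ⟨?_, by simp⟩, ?_⟩, rfl⟩
      · simp [BrickAdj]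
      · intro v hv h0
        simp only [List.mem_cons, List.not_mem_nil, or_false] at hv
        rcases hv with rfl | rfl
        · exact hs
        · exact absurd rfl h0
    · rintro ⟨h, hl⟩
      exact (h.1.eq_of_length_le (by simp [hl])).symm
  | succ n ih =>
    simp only [arcs, Finset.mem_image, Finset.mem_filter, Finset.mem_sigma, Sigma.exists, ih]
    constructor
    · rintro ⟨l, w, ⟨⟨⟨h, hl⟩, hw⟩, hD, hwl⟩, rfl⟩
      obtain ⟨u, t, l, rfl⟩ : ∃ u t l', l = u :: t :: l' := by
        match l, hl with
        | u :: t :: l', _ => exact ⟨u, t, l', rfl⟩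
      simp only [nexts, Finset.mem_erase, mem_nbrs] at hw
      refine ⟨⟨h.1.trans (List.suffix_cons _ _), ⟨?_, ?_⟩, ?_⟩, by simpa using hl⟩
      · exact List.isChain_cons_cons.2 ⟨adj_symm hw.2, h.2.1.1⟩
      · exact List.nodup_cons.2 ⟨hwl, h.2.1.2⟩
      · intro v hv h0
        rcases List.mem_cons.1 hv with rfl | hv
        · exact hD
        · exact h.2.2 v hv h0
    · rintro ⟨h, hl⟩
      match l, hl with
      | w :: u :: t :: l, hl =>
        have h0 : w ∉ u :: t :: l := (List.nodup_cons.1 h.2.1.2).1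
        refine ⟨u :: t :: l, w, ⟨⟨⟨h.tail, by simpa using hl⟩, ?_⟩, ?_, h0⟩, rfl⟩
        · simp only [nexts, Finset.mem_erase, mem_nbrs]
          refine ⟨fun e => h0 (by simp [e]), adj_symm (List.isChain_cons_cons.1 h.2.1.1).1⟩
        · refine h.2.2 w (by simp) ?_
          rintro rfl
          have := getLast_of_suffix h.1 (List.cons_ne_nil _ _)
          rw [List.getLast_cons_cons] at this
          exact h0 (this ▸ List.getLast_mem _)

open Classical in
/-- Reversal of the part of a walk after its visit to `w`. -/
noncomputable def reverseLoop (w : ℤ × ℤ) (l : List (ℤ × ℤ)) : List (ℤ × ℤ) :=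
  (l.takeWhile (· ≠ w)).reverse ++ l.dropWhile (· ≠ w)

theorem reverseLoop_append {w : ℤ × ℤ} {A B : List (ℤ × ℤ)} (h : w ∉ A) :
    reverseLoop w (A ++ w :: B) = A.reverse ++ w :: B := by
  have h' : ∀ a ∈ A, decide (a ≠ w) = true := by
    intro a ha
    simp only [ne_eq, decide_not, Bool.not_eq_true', decide_eq_false_iff_not]
    rintro rfl
    exact h ha
  rw [reverseLoop, List.takeWhile_append_of_pos (by convert h'), List.dropWhile_append_of_pos
    (by convert h')]
  simp

/-- A walk in `D` followed by a step to the vertex `w` it has already visited, closing the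
loop `A`. -/
def IsRho (D : ℤ × ℤ → Prop) (A : List (ℤ × ℤ)) (w p : ℤ × ℤ) (l : List (ℤ × ℤ)) : Prop :=
  IsArc D (A ++ w :: p :: l) ∧ 2 ≤ A.length ∧ D w ∧ ∃ r ∈ A.head?, BrickAdj r w

theorem IsRho.suffix {D : ℤ × ℤ → Prop} {A : List (ℤ × ℤ)} {w p : ℤ × ℤ} {l : List (ℤ × ℤ)}
    (h : IsRho D A w p l) : [((0 : ℤ), (1 : ℤ)), (0, 0)] <:+ w :: p :: l := by
  rcases List.suffix_or_suffix_of_suffix h.1.1 (List.suffix_append A (w :: p :: l)) with h' | h'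
  · exact h'
  · rw [h'.eq_of_length_le (by simp)]

theorem IsRho.reverse {D : ℤ × ℤ → Prop} {A : List (ℤ × ℤ)} {w p : ℤ × ℤ}
    {l : List (ℤ × ℤ)} (h : IsRho D A w p l) : IsRho D A.reverse w p l := by
  have hsuf := h.suffix
  obtain ⟨⟨-, ⟨hc, hn⟩, hD⟩, hA, hw, r, hr, hrw⟩ := h
  rw [List.isChain_append] at hc
  rw [List.nodup_append] at hn
  refine ⟨⟨hsuf.trans (List.suffix_append _ _), ⟨?_, ?_⟩, ?_⟩, by simpa using hA, hw, ?_⟩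
  · rw [List.isChain_append, List.isChain_reverse]
    refine ⟨?_, hc.2.1, ?_⟩
    · exact hc.1.imp fun _ _ hab => adj_symm hab
    · intro x hx y hy
      rw [List.getLast?_reverse] at hx
      obtain rfl : w = y := by simpa using hy
      obtain rfl : x = r := Option.mem_unique hx hr
      exact hrw
  · rw [List.nodup_append]
    exact ⟨List.nodup_reverse.2 hn.1, hn.2.1, fun a ha => hn.2.2 a (List.mem_reverse.1 ha)⟩
  · intro v hv
    exact hD v (by simpa using hv)
  · have hne : A ≠ [] := by rintro rfl; simp at hA
    refine ⟨A.getLast hne, ?_, ?_⟩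
    · rw [List.head?_reverse, List.getLast?_eq_getLast_of_ne_nil hne]; rfl
    · exact hc.2.2 _ (by rw [List.getLast?_eq_getLast_of_ne_nil hne]; rfl) w (by simp)

theorem IsRho.phase_reverse {D : ℤ × ℤ → Prop} (hDU : ∀ v, D v → Upper v) {A : List (ℤ × ℤ)}
    {w p : ℤ × ℤ} {l : List (ℤ × ℤ)} (h : IsRho D A w p l) :
    phase (winding (w :: (A.reverse ++ w :: p :: l))) =
      -phase (winding (w :: (A ++ w :: p :: l))) := by
  have key : ∀ {A : List (ℤ × ℤ)} (h : IsRho D A w p l) (hne : A ≠ []),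
      winding (w :: (A ++ w :: p :: l)) =
        winding (w :: p :: l) - 4 * turn p w (A.getLast hne) := by
    rintro A ⟨h, hA, hw, r, hr, hrw⟩ hne
    match A, hA with
    | r' :: t :: m, _ =>
      obtain rfl : r' = r := by simpa using hr
      rw [List.getLast_cons_cons]
      exact winding_loop ⟨h.1, h.2.1, fun v hv h0 => hDU v (h.2.2 v hv h0)⟩ (hDU _ hw) hrw
  have hne : A ≠ [] := by rintro rfl; exact absurd h.2.1 (by simp)
  rw [key h hne, key h.reverse (by simpa using hne)]
  obtain ⟨⟨-, ⟨hc, hn⟩, hD⟩, hA, hw, r, hr, hrw⟩ := h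
  match A, hA with
  | r' :: t :: m, _ =>
    obtain rfl : r' = r := by simpa using hr
    simp only [List.getLast_reverse, List.head_cons]
    rw [List.isChain_append] at hc
    rw [List.nodup_append] at hn
    have hq := hc.2.2 ((r' :: t :: m).getLast hne)
      (by rw [List.getLast?_eq_getLast_of_ne_nil hne]; rfl) w (by simp)
    have hp := (List.isChain_cons_cons.1 hc.2.1).1
    rcases turn_cases hp (adj_symm hq) (adj_symm hrw)
      (hn.2.2 _ (List.getLast_mem hne) p (by simp)).symm
      (hn.2.2 r' (by simp) p (by simp)).symm
      (fun e => (List.nodup_cons.1 hn.1).1 (by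
        rw [List.getLast_cons_cons] at e; exact e ▸ List.getLast_mem _)) with ⟨e1, e2⟩ | ⟨e1, e2⟩
    all_goals
      rw [e1, e2]
      have := phase_add_four (winding (w :: p :: l))
      simp only [mul_one, mul_neg, sub_neg_eq_add]
      linarith

open Classical in
theorem sum_rho_eq_zero {D : ℤ × ℤ → Prop} (hs : D (0, 1)) (hDU : ∀ v, D v → Upper v) (n : ℕ) :
    ∑ p ∈ ((arcs D n).sigma nexts).filter (fun p => D p.2 ∧ p.2 ∈ p.1),
      phase (winding (p.2 :: p.1)) = 0 := by
  set R := ((arcs D n).sigma nexts).filter (fun p => D p.2 ∧ p.2 ∈ p.1) with hR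
  have hmem : ∀ L w, (⟨L, w⟩ : (_ : List (ℤ × ℤ)) × (ℤ × ℤ)) ∈ R ↔
      ∃ A p l, IsRho D A w p l ∧ L = A ++ w :: p :: l ∧ L.length = n + 2 := by
    intro L w
    simp only [hR, Finset.mem_filter, Finset.mem_sigma, mem_arcs hs]
    constructor
    · rintro ⟨⟨⟨h, hL⟩, hw⟩, hDw, hwL⟩
      obtain ⟨A, B, rfl⟩ := List.append_of_mem hwL
      have hB : B ≠ [] := by
        rintro rfl
        have := getLast_of_suffix h.1 (by simp)
        rw [List.getLast_append_singleton] at this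
        subst this
        simpa [Upper] using hDU _ hDw
      obtain ⟨p, l, rfl⟩ := List.exists_cons_of_ne_nil hB
      match A, hw with
      | [], hw => simp [nexts, mem_nbrs, BrickAdj] at hw
      | [a], hw => simp [nexts] at hw
      | r :: t :: m, hw =>
        simp only [List.cons_append, nexts, Finset.mem_erase, mem_nbrs] at hw
        exact ⟨_, p, l, ⟨h, by simp, hDw, r, by simp, hw.2⟩, rfl, hL⟩
    · rintro ⟨A, p, l, ⟨h, hA, hDw, r, hr, hrw⟩, rfl, hL⟩
      refine ⟨⟨⟨h, hL⟩, ?_⟩, hDw, by simp⟩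
      match A, hA with
      | r' :: t :: m, _ =>
        obtain rfl : r' = r := by simpa using hr
        simp only [List.cons_append, nexts, Finset.mem_erase, mem_nbrs]
        refine ⟨?_, hrw⟩
        rintro rfl
        have := h.2.1.2
        simp at this
  have hnot : ∀ {A w p l}, IsRho D A w p l → w ∉ A := by
    intro A w p l h hw
    exact (List.nodup_append.1 h.1.2.1.2).2.2 w hw w (by simp) rfl
  have hsum : ∑ q ∈ R, phase (winding (q.2 :: q.1)) =
      ∑ q ∈ R, -phase (winding (q.2 :: q.1)) := by
    refine Finset.sum_nbij' (fun q => ⟨reverseLoop q.2 q.1, q.2⟩)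
      (fun q => ⟨reverseLoop q.2 q.1, q.2⟩) ?_ ?_ ?_ ?_ ?_
    · rintro ⟨L, w⟩ hq
      obtain ⟨A, p, l, h, rfl, hL⟩ := (hmem _ _).1 hq
      rw [hmem]
      simp only [reverseLoop_append (hnot h)]
      exact ⟨_, p, l, h.reverse, rfl, by simpa using hL⟩
    · rintro ⟨L, w⟩ hq
      obtain ⟨A, p, l, h, rfl, hL⟩ := (hmem _ _).1 hq
      rw [hmem]
      simp only [reverseLoop_append (hnot h)]
      exact ⟨_, p, l, h.reverse, rfl, by simpa using hL⟩
    · rintro ⟨L, w⟩ hq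
      obtain ⟨A, p, l, h, rfl, hL⟩ := (hmem _ _).1 hq
      simp only [reverseLoop_append (hnot h), reverseLoop_append (hnot h.reverse),
        List.reverse_reverse]
    · rintro ⟨L, w⟩ hq
      obtain ⟨A, p, l, h, rfl, hL⟩ := (hmem _ _).1 hq
      simp only [reverseLoop_append (hnot h), reverseLoop_append (hnot h.reverse),
        List.reverse_reverse]
    · rintro ⟨L, w⟩ hq
      obtain ⟨A, p, l, h, rfl, hL⟩ := (hmem _ _).1 hq
      simp only [reverseLoop_append (hnot h), h.phase_reverse hDU, neg_neg]
  rw [Finset.sum_neg_distrib] at hsum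
  linarith

/-- The parafermionic observable summed over the arcs with `n + 1` steps. -/
noncomputable def observable (D : ℤ × ℤ → Prop) (n : ℕ) : ℝ :=
  ∑ l ∈ arcs D n, xc ^ n * phase (winding l)

open Classical in
/-- The arcs with `n + 1` steps in `D`, with a step leaving `D`. -/
noncomputable def exits (D : ℤ × ℤ → Prop) (n : ℕ) : Finset ((_ : List (ℤ × ℤ)) × (ℤ × ℤ)) :=
  ((arcs D n).sigma nexts).filter fun p => ¬ D p.2

/-- The contribution to the observable of the arcs leaving `D`. -/
noncomputable def flux (D : ℤ × ℤ → Prop) (n : ℕ) : ℝ :=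
  ∑ p ∈ exits D n, xc ^ (n + 1) * phase (winding (p.2 :: p.1))

theorem observable_eq {D : ℤ × ℤ → Prop} (hs : D (0, 1)) (hDU : ∀ v, D v → Upper v) (n : ℕ) :
    observable D n = flux D n + observable D (n + 1) := by
  classical
  have h1 : observable D n =
      ∑ p ∈ (arcs D n).sigma nexts, xc ^ (n + 1) * phase (winding (p.2 :: p.1)) := by
    rw [Finset.sum_sigma, observable]
    refine Finset.sum_congr rfl fun l hl => ?_
    obtain ⟨h, hlen⟩ := (mem_arcs hs).1 hl
    match l, hlen with
    | u :: t :: l, _ =>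
      rw [phase_eq_sum (List.isChain_cons_cons.1 h.2.1.1).1, pow_succ, ← mul_assoc, Finset.mul_sum]
  have h2 : observable D (n + 1) =
      ∑ p ∈ ((arcs D n).sigma nexts).filter (fun p => D p.2 ∧ p.2 ∉ p.1),
        xc ^ (n + 1) * phase (winding (p.2 :: p.1)) := by
    rw [observable, arcs, Finset.sum_image]
    rintro ⟨l, w⟩ _ ⟨l', w'⟩ _ h
    simp only [List.cons.injEq] at h
    obtain ⟨rfl, rfl⟩ := h
    rfl
  have h3 := sum_rho_eq_zero hs hDU n
  rw [h1, h2, flux, exits, ← Finset.sum_filter_add_sum_filter_not _ (fun p => D p.2), add_comm]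
  congr 1
  rw [← Finset.sum_filter_add_sum_filter_not _ (fun p => p.2 ∈ p.1), Finset.filter_filter,
    Finset.filter_filter, ← Finset.mul_sum, h3, mul_zero, zero_add]

theorem observable_zero (D : ℤ × ℤ → Prop) : observable D 0 = 1 := by
  simp [observable, arcs, winding, heading, phase]

theorem sum_flux_add_observable {D : ℤ × ℤ → Prop} (hs : D (0, 1)) (hDU : ∀ v, D v → Upper v)
    (n : ℕ) : ∑ k ∈ Finset.range n, flux D k + observable D n = 1 := by
  induction n with
  | zero => simp [observable_zero]
  | succ n ih => rw [Finset.sum_range_succ, add_assoc, ← observable_eq hs hDU, ih]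

theorem crossings_eq_zero_of_above {z : ℤ × ℤ} (l : List (ℤ × ℤ)) (h : ∀ b ∈ l, b.2 ≤ z.2) :
    crossings z l = 0 := by
  induction l with
  | nil => rfl
  | cons b l ih =>
    cases l with
    | nil => rfl
    | cons c l =>
      simp only [List.mem_cons, forall_eq_or_imp] at h
      simp only [crossings]
      rw [ih (by simpa using h.2), cross_eq_zero_of_nonneg] <;> simp <;> omega

theorem crossings_eq_zero_of_left {z : ℤ × ℤ} (l : List (ℤ × ℤ)) (h : ∀ b ∈ l, z.1 ≤ b.1) :
    crossings z l = 0 := by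
  induction l with
  | nil => rfl
  | cons b l ih =>
    cases l with
    | nil => rfl
    | cons c l =>
      simp only [List.mem_cons, forall_eq_or_imp] at h
      simp only [crossings]
      rw [ih (by simpa using h.2), cross, if_neg] <;> simp
      omega

theorem crossings_of_right {z : ℤ × ℤ} (b : ℤ × ℤ) (l : List (ℤ × ℤ))
    (h : ∀ v ∈ b :: l, v.1 < z.1) :
    crossings z (b :: l) = (if b.2 ≤ z.2 then 1 else 0) -
      (if ((b :: l).getLast (List.cons_ne_nil _ _)).2 ≤ z.2 then 1 else 0) := by
  induction l generalizing b with
  | nil => simp only [crossings, List.getLast_singleton]; exact (sub_self _).symm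
  | cons c l ih =>
    have hc := h c (by simp)
    simp only [crossings]
    rw [ih c (fun v hv => h v (List.mem_cons_of_mem _ hv)), List.getLast_cons_cons, cross,
      if_pos (by simpa using hc)]
    simp

theorem IsArc.last {D : ℤ × ℤ → Prop} {b : ℤ × ℤ} {l : List (ℤ × ℤ)} (h : IsArc D (b :: l)) :
    (b :: l).getLast (List.cons_ne_nil _ _) = (0, 0) :=
  getLast_of_suffix h.1 (List.cons_ne_nil _ _)

theorem IsArc.head_ne {D : ℤ × ℤ → Prop} {u t : ℤ × ℤ} {l : List (ℤ × ℤ)}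
    (h : IsArc D (u :: t :: l)) : u ≠ (0, 0) := by
  rintro rfl
  have := h.last
  rw [List.getLast_cons_cons] at this
  exact (List.nodup_cons.1 h.2.1.2).1 (this ▸ List.getLast_mem _)

theorem IsArc.eq_of_head {D : ℤ × ℤ → Prop} {t : ℤ × ℤ} {l : List (ℤ × ℤ)}
    (h : IsArc D ((0, 1) :: t :: l)) : t = (0, 0) ∧ l = [] := by
  obtain ⟨m, hm⟩ := h.1
  cases m with
  | nil => simpa using hm.symm
  | cons c m =>
    simp only [List.cons_append, List.cons.injEq] at hm
    exact absurd (show (0, 1) ∈ t :: l by rw [← hm.2]; simp) (List.nodup_cons.1 h.2.1.2).1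

theorem IsArc.mono {D D' : ℤ × ℤ → Prop} (hD : ∀ v, D v → D' v) {l : List (ℤ × ℤ)}
    (h : IsArc D l) : IsArc D' l :=
  ⟨h.1, h.2.1, fun v hv h0 => hD v (h.2.2 v hv h0)⟩

theorem IsArc.nonneg {l : List (ℤ × ℤ)} (h : IsArc Upper l) {v : ℤ × ℤ} (hv : v ∈ l) :
    0 ≤ v.2 := by
  by_cases h0 : v = (0, 0)
  · simp [h0]
  · have := h.2.2 v hv h0
    simp only [Upper] at this
    omega

section Exit

variable {D : ℤ × ℤ → Prop} {u t w : ℤ × ℤ} {l : List (ℤ × ℤ)}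

theorem winding_exit (hDU : ∀ v, D v → Upper v) (h : IsArc D (u :: t :: l))
    (hw : w ∈ nexts (u :: t :: l)) (hwD : ¬ D w) :
    winding (w :: u :: t :: l) = heading u w + 6 * crossings w (u :: t :: l) := by
  simp only [nexts, Finset.mem_erase, mem_nbrs] at hw
  have hU := h.mono hDU
  have hu : 1 ≤ u.2 := hU.2.2 u (by simp) h.head_ne
  have hw0 : 0 ≤ w.2 := by
    have := hw.2
    simp only [BrickAdj] at this
    omega
  have hwa : w ≠ (0, 0) := by
    rintro rfl
    have hus : u = (0, 1) := by
      have := hw.2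
      simp only [BrickAdj] at this
      ext <;> simp <;> omega
    subst hus
    exact hw.1 h.eq_of_head.1.symm
  have hwl : w ∉ u :: t :: l := fun hm => hwD (h.2.2 w hm hwa)
  rw [winding, winding_eq hU, ← heading_extend hU hw.2 hw0 hwl]

theorem phase_top (hDU : ∀ v, D v → Upper v) (h : IsArc D (u :: t :: l))
    (hw : w ∈ nexts (u :: t :: l)) (hwD : ¬ D w) (huw : u.2 < w.2)
    (hl : ∀ v ∈ u :: t :: l, v.2 ≤ w.2) : phase (winding (w :: u :: t :: l)) = 1 := by
  rw [winding_exit hDU h hw hwD, crossings_eq_zero_of_above _ hl, heading, if_pos huw]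
  simp [phase]

theorem phase_bottom (hDU : ∀ v, D v → Upper v) (h : IsArc D (u :: t :: l))
    (hw : w ∈ nexts (u :: t :: l)) (hwD : ¬ D w) (huw : w.2 < u.2) (hw0 : w.2 = 0) :
    phase (winding (w :: u :: t :: l)) = Real.cos (3 * Real.pi / 8) := by
  rw [winding_exit hDU h hw hwD, heading, if_neg huw.not_gt, if_pos huw]
  obtain ⟨m, hm⟩ := h.1
  have h1 : crossings w (u :: t :: l) = cross (w - (0, 0)) (w - (0, 1)) := by
    rw [← hm]
    cases m with
    | nil => simp [crossings]
    | cons c m =>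
      have h2 := crossings_append w c (0, 0) (m ++ [(0, 1)]) []
      rw [show c :: m ++ [((0 : ℤ), (1 : ℤ)), (0, 0)] = c :: (m ++ [(0, 1)]) ++ (0, 0) :: [] by simp,
        h2, crossings_eq_zero_of_below]
      · simp [crossings]
      · intro b hb
        have hb' : b ∈ u :: t :: l := by
          rw [← hm]
          simp only [List.mem_cons, List.mem_append, List.cons_append, List.not_mem_nil,
            or_false] at hb ⊢
          tauto
        have hnd := h.2.1.2
        rw [← hm, show c :: m ++ [((0 : ℤ), (1 : ℤ)), (0, 0)] =
          c :: (m ++ [(0, 1)]) ++ (0, 0) :: [] by simp, List.nodup_append] at hnd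
        have := hDU b (h.2.2 b hb' (hnd.2.2 b hb _ (by simp)))
        simp only [Upper] at this
        omega
  rw [h1]
  by_cases h3 : 0 < w.1
  · have h4 : cross (w - (0, 0)) (w - (0, 1)) = -1 := by simp [cross, hw0, h3]
    rw [h4, phase, ← Real.cos_neg]
    norm_num
    congr 1
    ring
  · have h4 : cross (w - (0, 0)) (w - (0, 1)) = 0 := by simp [cross, h3]
    rw [h4, phase, ← Real.cos_neg]
    norm_num
    congr 1
    ring

theorem phase_nonneg {k : ℤ} (h1 : -3 ≤ k) (h2 : k ≤ 3) : 0 ≤ phase k := by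
  have h1' : (-3 : ℝ) ≤ k := by exact_mod_cast h1
  have h2' : (k : ℝ) ≤ 3 := by exact_mod_cast h2
  have := Real.pi_pos
  exact Real.cos_nonneg_of_mem_Icc ⟨by nlinarith, by nlinarith⟩

theorem phase_side_nonneg (hDU : ∀ v, D v → Upper v) (h : IsArc D (u :: t :: l))
    (hw : w ∈ nexts (u :: t :: l)) (hwD : ¬ D w) (huw : u.2 = w.2)
    (hl : (∀ v ∈ u :: t :: l, v.1 < w.1) ∨ ∀ v ∈ u :: t :: l, w.1 ≤ v.1) :
    0 ≤ phase (winding (w :: u :: t :: l)) := by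
  have hc : crossings w (u :: t :: l) = 0 := by
    rcases hl with hl | hl
    · have h1 := (h.mono hDU).nonneg (v := u) (by simp)
      rw [crossings_of_right _ _ hl, h.last, if_pos huw.le, if_pos (by simp; omega), sub_self]
    · exact crossings_eq_zero_of_left _ hl
  rw [winding_exit hDU h hw hwD, hc]
  apply phase_nonneg <;>
  · simp only [heading]
    split_ifs <;> omega

end Exit

/-- The horizontal strip made of the rows `1, …, T`. -/
def strip (T : ℕ) (v : ℤ × ℤ) : Prop := 1 ≤ v.2 ∧ v.2 ≤ T

/-- The part of a strip at horizontal distance at most `L` from the origin. -/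
def box (T L : ℕ) (v : ℤ × ℤ) : Prop := strip T v ∧ -L ≤ v.1 ∧ v.1 ≤ L

/-- An arc of the strip of height `T` that can be continued by a step up out of the strip. -/
def IsBridge (T : ℕ) (l : List (ℤ × ℤ)) : Prop :=
  IsArc (strip T) l ∧ ∃ u ∈ l.head?, u.2 = T ∧ Even (u.1 + u.2)

/-- An arc of the strip of height `T` that can be continued by a step down out of the strip. -/
def IsReturn (T : ℕ) (l : List (ℤ × ℤ)) : Prop :=
  IsArc (strip T) l ∧ ∃ u ∈ l.head?, u.2 = 1 ∧ ¬ Even (u.1 + u.2) ∧ u ≠ (0, 1)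

theorem vert_ne_of_arc {T : ℕ} {u t : ℤ × ℤ} {l : List (ℤ × ℤ)}
    (h : IsArc (strip T) (u :: t :: l)) (hu : Even (u.1 + u.2)) (huT : u.2 = T) :
    vert u ≠ t := by
  rintro rfl
  have h1 := (h.2.2 u (by simp) h.head_ne)
  have h2 := (h.2.2 (vert u) (by simp))
  simp only [strip, vert, if_pos hu, ne_eq, Prod.mk.injEq] at h1 h2
  omega

open Classical in
theorem sum_exit_strip {T : ℕ} {u t : ℤ × ℤ} {l : List (ℤ × ℤ)}
    (h : IsArc (strip T) (u :: t :: l)) :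
    ∑ w ∈ (nexts (u :: t :: l)).filter (fun w => ¬ strip T w),
      phase (winding (w :: u :: t :: l)) =
    (if IsBridge T (u :: t :: l) then 1 else 0) +
      (if IsReturn T (u :: t :: l) then Real.cos (3 * Real.pi / 8) else 0) := by
  have hDU : ∀ v, strip T v → Upper v := fun v hv => hv.1
  have hu : strip T u := h.2.2 u (by simp) h.head_ne
  have hB : IsBridge T (u :: t :: l) ↔ u.2 = T ∧ Even (u.1 + u.2) := by
    simp [IsBridge, h]
  have hR : IsReturn T (u :: t :: l) ↔ u.2 = 1 ∧ ¬ Even (u.1 + u.2) ∧ u ≠ (0, 1) := by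
    simp [IsReturn, h]
  have hmem : ∀ w, w ∈ (nexts (u :: t :: l)).filter (fun w => ¬ strip T w) ↔
      w = vert u ∧ w ≠ t ∧ ¬ strip T w := by
    intro w
    simp only [Finset.mem_filter, nexts, Finset.mem_erase, nbrs, Finset.mem_insert,
      Finset.mem_singleton]
    constructor
    · rintro ⟨⟨h1, rfl | rfl | h2⟩, h3⟩
      · exact absurd hu h3
      · exact absurd hu h3
      · exact ⟨h2, h1, h3⟩
    · rintro ⟨h1, h2, h3⟩
      exact ⟨⟨h2, .inr (.inr h1)⟩, h3⟩
  by_cases he : Even (u.1 + u.2)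
  · rw [if_neg (show ¬ IsReturn T (u :: t :: l) by rw [hR]; tauto), add_zero]
    split_ifs with hb
    · rw [hB] at hb
      have hs : (nexts (u :: t :: l)).filter (fun w => ¬ strip T w) = {vert u} := by
        ext w
        rw [hmem, Finset.mem_singleton]
        refine ⟨fun h => h.1, ?_⟩
        rintro rfl
        refine ⟨rfl, vert_ne_of_arc h he hb.1, ?_⟩
        simp only [strip, vert, if_pos he]
        omega
      have hv : vert u ∈ (nexts (u :: t :: l)).filter (fun w => ¬ strip T w) := by simp [hs]
      rw [Finset.mem_filter] at hv
      rw [hs, Finset.sum_singleton, phase_top hDU h hv.1 hv.2]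
      · simp [vert, if_pos he]
      · intro v hv
        simp only [vert, if_pos he]
        by_cases h0 : v = (0, 0)
        · have := hu.1
          rw [h0]
          change (0 : ℤ) ≤ u.2 + 1
          omega
        · have := (h.2.2 v hv h0).2
          rw [hb.1]
          omega
    · apply Finset.sum_eq_zero
      intro w hw
      rw [hmem] at hw
      obtain ⟨rfl, -, h3⟩ := hw
      rw [hB] at hb
      have huT : u.2 ≠ T := fun h => hb ⟨h, he⟩
      simp only [strip, vert, if_pos he] at h3 hu
      omega
  · rw [if_neg (show ¬ IsBridge T (u :: t :: l) by rw [hB]; tauto), zero_add]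
    split_ifs with hb
    · rw [hR] at hb
      have hs : (nexts (u :: t :: l)).filter (fun w => ¬ strip T w) = {vert u} := by
        ext w
        rw [hmem, Finset.mem_singleton]
        refine ⟨fun h => h.1, ?_⟩
        rintro rfl
        refine ⟨rfl, ?_, ?_⟩
        · rintro rfl
          have h0 : vert u = (0, 0) := by
            by_contra h0
            have := h.2.2 (vert u) (by simp) h0
            simp only [strip, vert, if_neg he] at this
            omega
          simp only [vert, if_neg he, Prod.mk.injEq] at h0
          exact hb.2.2 (Prod.ext h0.1 hb.1)
        · simp only [strip, vert, if_neg he]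
          omega
      have hv : vert u ∈ (nexts (u :: t :: l)).filter (fun w => ¬ strip T w) := by simp [hs]
      rw [Finset.mem_filter] at hv
      rw [hs, Finset.sum_singleton, phase_bottom hDU h hv.1 hv.2]
      · simp [vert, if_neg he]
      · simp only [vert, if_neg he]
        omega
    · apply Finset.sum_eq_zero
      intro w hw
      rw [hmem] at hw
      obtain ⟨rfl, h2, h3⟩ := hw
      rw [hR] at hb
      simp only [strip, vert, if_neg he] at h3 hu
      have hu1 : u.2 = 1 := by omega
      have : u = (0, 1) := by
        by_contra h0
        exact hb ⟨hu1, he, h0⟩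
      subst this
      exact absurd h.eq_of_head.1.symm (by simpa [vert] using h2)

open Classical in
theorem le_sum_exit_box {T L : ℕ} {u t : ℤ × ℤ} {l : List (ℤ × ℤ)}
    (h : IsArc (box T L) (u :: t :: l)) :
    (if IsBridge T (u :: t :: l) then 1 else 0) ≤
    ∑ w ∈ (nexts (u :: t :: l)).filter (fun w => ¬ box T L w),
      phase (winding (w :: u :: t :: l)) := by
  have hDU : ∀ v, box T L v → Upper v := fun v hv => hv.1.1
  have hS : IsArc (strip T) (u :: t :: l) := h.mono fun v hv => hv.1
  have hu : box T L u := h.2.2 u (by simp) h.head_ne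
  have hl : ∀ v ∈ u :: t :: l, 0 ≤ v.2 ∧ v.2 ≤ T ∧ -L ≤ v.1 ∧ v.1 ≤ L := by
    intro v hv
    by_cases h0 : v = (0, 0)
    · simp [h0]
    · have := h.2.2 v hv h0
      simp only [box, strip] at this
      omega
  have hpos : ∀ w ∈ (nexts (u :: t :: l)).filter (fun w => ¬ box T L w),
      0 ≤ phase (winding (w :: u :: t :: l)) := by
    intro w hw
    rw [Finset.mem_filter] at hw
    obtain ⟨hw, hwD⟩ := hw
    have hwn := hw
    simp only [nexts, Finset.mem_erase, mem_nbrs] at hwn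
    have hadj := hwn.2
    simp only [BrickAdj] at hadj
    simp only [box, strip] at hwD hu
    rcases lt_trichotomy u.2 w.2 with h1 | h1 | h1
    · rw [phase_top hDU h hw (by simpa only [box, strip] using hwD) h1]
      · exact zero_le_one
      · intro v hv
        have := hl v hv
        omega
    · apply phase_side_nonneg hDU h hw (by simpa only [box, strip] using hwD) h1
      by_cases h2 : u.1 < w.1
      · left
        intro v hv
        have := hl v hv
        omega
      · right
        intro v hv
        have := hl v hv
        omega
    · rw [phase_bottom hDU h hw (by simpa only [box, strip] using hwD) h1 (by omega)]
      exact Real.cos_nonneg_of_mem_Icc ⟨by linarith [Real.pi_pos], by linarith [Real.pi_pos]⟩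
  split_ifs with hb
  · obtain ⟨-, u', hu', huT, he⟩ := hb
    obtain rfl : u = u' := by simpa using hu'
    have hvb : ¬ box T L (vert u) := by
      simp only [box, strip, vert, if_pos he]
      omega
    have hvn : vert u ∈ nexts (u :: t :: l) := by
      simp only [nexts, Finset.mem_erase, nbrs, Finset.mem_insert, Finset.mem_singleton, or_true,
        and_true]
      exact vert_ne_of_arc hS he huT
    have hv : vert u ∈ (nexts (u :: t :: l)).filter (fun w => ¬ box T L w) :=
      Finset.mem_filter.2 ⟨hvn, hvb⟩
    refine le_trans (le_of_eq ?_) (Finset.single_le_sum hpos hv)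
    rw [phase_top hDU h hvn hvb]
    · simp [vert, if_pos he]
    · intro v hv
      have := hl v hv
      simp only [vert, if_pos he]
      omega
  · exact Finset.sum_nonneg hpos

theorem abs_sub_getLast_le (b : ℤ × ℤ) (l : List (ℤ × ℤ)) (h : (b :: l).IsChain BrickAdj) :
    ∀ v ∈ b :: l, |v.1 - ((b :: l).getLast (List.cons_ne_nil _ _)).1| ≤ l.length ∧
      |v.2 - ((b :: l).getLast (List.cons_ne_nil _ _)).2| ≤ l.length := by
  induction l generalizing b with
  | nil => simp
  | cons c l ih =>
    rw [List.isChain_cons_cons] at h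
    have h1 := ih c h.2
    have h2 := h1 c (by simp)
    have h3 := h.1
    rw [List.getLast_cons_cons, List.length_cons]
    intro v hv
    push_cast
    rw [List.mem_cons] at hv
    rcases hv with rfl | hv
    · simp only [BrickAdj] at h3
      simp only [abs_le] at h2 ⊢
      omega
    · have := h1 v hv
      constructor <;> linarith [this.1, this.2]

theorem IsArc.abs_le {D : ℤ × ℤ → Prop} {l : List (ℤ × ℤ)} (h : IsArc D l) {v : ℤ × ℤ}
    (hv : v ∈ l) : |v.1| < l.length ∧ |v.2| < l.length := by
  cases l with
  | nil => simp at hv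
  | cons b l =>
    have := abs_sub_getLast_le b l h.2.1.1 v hv
    rw [h.last] at this
    simp only [sub_zero] at this
    simp only [List.length_cons]
    push_cast
    constructor <;> linarith [this.1, this.2]

open Classical in
theorem flux_eq (D : ℤ × ℤ → Prop) (n : ℕ) :
    flux D n = ∑ l ∈ arcs D n, xc ^ (n + 1) *
      ∑ w ∈ (nexts l).filter (fun w => ¬ D w), phase (winding (w :: l)) := by
  rw [flux, exits]
  simp only [Finset.sum_filter, Finset.sum_sigma, Finset.mul_sum, mul_ite, mul_zero]

open Classical in
theorem flux_strip {T : ℕ} (hT : 1 ≤ T) (n : ℕ) :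
    flux (strip T) n = ∑ l ∈ arcs (strip T) n, xc ^ (n + 1) *
      ((if IsBridge T l then 1 else 0) +
        (if IsReturn T l then Real.cos (3 * Real.pi / 8) else 0)) := by
  rw [flux_eq]
  refine Finset.sum_congr rfl fun l hl => ?_
  obtain ⟨h, hlen⟩ := (mem_arcs (by simp [strip]; omega)).1 hl
  match l, hlen with
  | u :: t :: l, _ => rw [sum_exit_strip h]

open Classical in
theorem le_flux_box {T L : ℕ} (hT : 1 ≤ T) (n : ℕ) :
    ∑ l ∈ arcs (box T L) n, xc ^ (n + 1) * (if IsBridge T l then 1 else 0) ≤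
      flux (box T L) n := by
  rw [flux_eq]
  refine Finset.sum_le_sum fun l hl => mul_le_mul_of_nonneg_left ?_ (by have := xc_pos; positivity)
  obtain ⟨h, hlen⟩ := (mem_arcs (by simp [box, strip]; omega)).1 hl
  match l, hlen with
  | u :: t :: l, _ => exact le_sum_exit_box h

theorem exists_arcs_box_eq_empty (T L : ℕ) (hT : 1 ≤ T) :
    ∃ N₀, ∀ N ≥ N₀, arcs (box T L) N = ∅ := by
  refine ⟨(Finset.Icc (-(L : ℤ)) L ×ˢ Finset.Icc (0 : ℤ) T).card, fun N hN => ?_⟩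
  rw [Finset.eq_empty_iff_forall_notMem]
  intro l hl
  obtain ⟨h, hlen⟩ := (mem_arcs (by simp [box, strip]; omega)).1 hl
  have : l.toFinset ⊆ Finset.Icc (-(L : ℤ)) L ×ˢ Finset.Icc (0 : ℤ) T := by
    intro v hv
    rw [List.mem_toFinset] at hv
    simp only [Finset.mem_product, Finset.mem_Icc]
    by_cases h0 : v = (0, 0)
    · simp [h0]
    · have := h.2.2 v hv h0
      simp only [box, strip] at this
      omega
  have := Finset.card_le_card this
  rw [List.toFinset_card_of_nodup h.2.1.2] at this
  omega

theorem sum_bridges_le {T : ℕ} (hT : 1 ≤ T) (F : Finset (List (ℤ × ℤ)))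
    (hF : ∀ l ∈ F, IsBridge T l) : ∑ l ∈ F, xc ^ l.length ≤ xc := by
  classical
  set M := F.sup List.length with hM
  obtain ⟨N₀, hN₀⟩ := exists_arcs_box_eq_empty T M hT
  set N := max N₀ M with hN
  have hx := xc_pos
  have hs : box T M (0, 1) := by simp [box, strip]; omega
  have h1 := sum_flux_add_observable hs (fun v hv => hv.1.1) N
  rw [observable, hN₀ N (le_max_left _ _), Finset.sum_empty, add_zero] at h1
  have hlen : ∀ l ∈ F, l.length ≤ M := fun l hl => Finset.le_sup (f := List.length) hl
  have h2 : ∀ l ∈ F, 2 ≤ l.length := by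
    intro l hl
    simpa using (hF l hl).1.1.length_le
  have h3 : ∑ l ∈ F, xc ^ (l.length - 1) ≤ 1 := by
    have h4 : ∀ l ∈ F, l.length - 2 ∈ Finset.range N := by
      intro l hl
      have := hlen l hl
      have := h2 l hl
      have := le_max_right N₀ M
      rw [Finset.mem_range]
      omega
    rw [← h1, ← Finset.sum_fiberwise_of_maps_to h4]
    refine Finset.sum_le_sum fun k _ => le_trans ?_ (le_flux_box hT k)
    simp only [mul_ite, mul_one, mul_zero]
    rw [← Finset.sum_filter]
    calc ∑ l ∈ F with l.length - 2 = k, xc ^ (l.length - 1)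
        = ∑ l ∈ F with l.length - 2 = k, xc ^ (k + 1) := by
          refine Finset.sum_congr rfl fun l hl => ?_
          rw [Finset.mem_filter] at hl
          have := h2 l hl.1
          congr 1
          omega
      _ ≤ _ := by
          refine Finset.sum_le_sum_of_subset_of_nonneg ?_ fun _ _ _ => by positivity
          intro l hl
          rw [Finset.mem_filter] at hl ⊢
          have hb := hF l hl.1
          refine ⟨(mem_arcs hs).2 ⟨⟨hb.1.1, hb.1.2.1, fun v hv h0 => ⟨hb.1.2.2 v hv h0, ?_⟩⟩, ?_⟩,
            hb⟩
          · have h5 := (hb.1.abs_le hv).1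
            have h6 := hlen l hl.1
            rw [abs_lt] at h5
            omega
          · have := h2 l hl.1
            omega
  calc ∑ l ∈ F, xc ^ l.length = xc * ∑ l ∈ F, xc ^ (l.length - 1) := by
        rw [Finset.mul_sum]
        refine Finset.sum_congr rfl fun l hl => ?_
        rw [← pow_succ']
        congr 1
        have := h2 l hl
        omega
    _ ≤ xc := mul_le_of_le_one_right hx.le h3

/-- The generating function of a set of lists, counted by length. -/
noncomputable def gf (x : ℝ≥0∞) (S : Set (List (ℤ × ℤ))) : ℝ≥0∞ :=
  ∑' l : S, x ^ l.1.length

section GeneratingFunction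

variable {x : ℝ≥0∞} {S P Q : Set (List (ℤ × ℤ))}

theorem gf_mono (h : S ⊆ P) : gf x S ≤ gf x P :=
  ENNReal.tsum_mono_subtype (fun l : List (ℤ × ℤ) => x ^ l.length) h

theorem gf_union_le : gf x (S ∪ P) ≤ gf x S + gf x P :=
  ENNReal.tsum_union_le (fun l : List (ℤ × ℤ) => x ^ l.length) S P

theorem gf_singleton (l : List (ℤ × ℤ)) : gf x {l} = x ^ l.length :=
  tsum_singleton l fun l : List (ℤ × ℤ) => x ^ l.length

theorem le_gf {l : List (ℤ × ℤ)} (h : l ∈ S) : x ^ l.length ≤ gf x S := by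
  rw [← gf_singleton]
  exact gf_mono (Set.singleton_subset_iff.2 h)

theorem gf_mul_le (i : ℕ) (f : List (ℤ × ℤ) → List (ℤ × ℤ) → List (ℤ × ℤ))
    (h : ∀ l ∈ S, ∃ a ∈ P, ∃ b ∈ Q, f a b = l ∧ l.length + i = a.length + b.length) :
    x ^ i * gf x S ≤ gf x P * gf x Q := by
  choose! a ha b hb hf hlen using h
  let g : S → P × Q := fun l => (⟨a l, ha l l.2⟩, ⟨b l, hb l l.2⟩)
  have hg : Function.Injective g := by
    intro l l' e
    simp only [g, Prod.mk.injEq, Subtype.mk.injEq] at e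
    exact Subtype.ext (by rw [← hf l l.2, ← hf l' l'.2, e.1, e.2])
  calc x ^ i * gf x S = ∑' l : S, x ^ ((g l).1.1.length) * x ^ ((g l).2.1.length) := by
        rw [gf, ← ENNReal.tsum_mul_left]
        refine tsum_congr fun l => ?_
        rw [← pow_add, ← pow_add, ← hlen l l.2, add_comm]
    _ ≤ ∑' p : P × Q, x ^ p.1.1.length * x ^ p.2.1.length :=
        ENNReal.tsum_comp_le_tsum_of_injective hg
          fun p : P × Q => x ^ p.1.1.length * x ^ p.2.1.length
    _ = gf x P * gf x Q := by
        rw [ENNReal.tsum_prod', gf, ← ENNReal.tsum_mul_right]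
        refine tsum_congr fun l => ?_
        exact ENNReal.tsum_mul_left (a := x ^ l.1.length) (f := fun b : Q => x ^ b.1.length)

theorem tsum_length (F : List (ℤ × ℤ) → ℝ≥0∞) :
    ∑' l, F l = ∑' n, ∑' l : {l : List (ℤ × ℤ) // l.length = n}, F l := by
  rw [← (Equiv.sigmaFiberEquiv (List.length (α := ℤ × ℤ))).tsum_eq, ENNReal.tsum_sigma']
  rfl

theorem gf_eq_tsum_length (S : Set (List (ℤ × ℤ))) :
    gf x S = ∑' n, ({l | l ∈ S ∧ l.length = n}.encard : ℝ≥0∞) * x ^ n := by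
  rw [gf, tsum_subtype S fun l => x ^ l.length, tsum_length]
  refine tsum_congr fun n => ?_
  rw [← ENNReal.tsum_set_const, tsum_subtype {l | l ∈ S ∧ l.length = n} fun _ => x ^ n]
  refine (tsum_subtype {l : List (ℤ × ℤ) | l.length = n} _).trans ?_
  refine tsum_congr fun l => ?_
  simp only [Set.indicator, Set.mem_ofPred_eq]
  split_ifs <;> simp_all

/-- The self-avoiding walks started at the origin, as lists with the last vertex first. -/
def walks : Set (List (ℤ × ℤ)) := {l | IsSAW l ∧ l.getLast? = some (0, 0)}

theorem finite_walks (n : ℕ) : {l | l ∈ walks ∧ l.length = n + 1}.Finite := by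
  induction n with
  | zero =>
    refine (Set.finite_singleton [((0 : ℤ), (0 : ℤ))]).subset ?_
    rintro l ⟨⟨-, h⟩, hl⟩
    obtain ⟨v, rfl⟩ := List.length_eq_one_iff.1 hl
    simpa using h
  | succ n ih =>
    refine (ih.biUnion fun l _ => ((nbrs (l.headD (0, 0))).finite_toSet.image (· :: l))).subset ?_
    rintro l ⟨⟨h, h0⟩, hl⟩
    match l, hl with
    | w :: u :: l, hl =>
      simp only [Set.mem_iUnion, Set.mem_image, Finset.mem_coe]
      refine ⟨u :: l, ⟨⟨⟨h.1.tail, h.2.tail⟩, by simpa using h0⟩, by simpa using hl⟩, w, ?_, rfl⟩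
      exact mem_nbrs.2 (adj_symm (List.isChain_cons_cons.1 h.1).1)

theorem brickSawCount_eq (n : ℕ) :
    brickSawCount n = {l | l ∈ walks ∧ l.length = n + 1}.ncard := by
  have hinj : Function.Injective fun ω : Fin (n + 1) → ℤ × ℤ => (List.ofFn ω).reverse :=
    fun _ _ h => List.ofFn_injective (List.reverse_injective h)
  rw [brickSawCount, ← Set.ncard_image_of_injective _ hinj]
  congr 1
  ext l
  simp only [Set.mem_image, Set.mem_ofPred_eq, walks]
  constructor
  · rintro ⟨ω, ⟨h0, hadj, hω⟩, rfl⟩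
    refine ⟨⟨⟨?_, ?_⟩, ?_⟩, by simp⟩
    · rw [List.isChain_reverse, List.isChain_iff_getElem]
      intro i hi
      simp only [List.length_ofFn] at hi
      simp only [List.getElem_ofFn]
      exact adj_symm (hadj ⟨i, by omega⟩)
    · rw [List.nodup_reverse]
      exact List.nodup_ofFn.2 hω
    · simp [List.getLast?_reverse, h0]
  · rintro ⟨⟨⟨hc, hn⟩, h0⟩, hl⟩
    have hl' : l.reverse.length = n + 1 := by simpa using hl
    refine ⟨fun i => l.reverse[i], ⟨?_, ?_, ?_⟩, ?_⟩
    · rw [List.getLast?_eq_head?_reverse, List.head?_eq_getElem?] at h0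
      exact (List.getElem_eq_iff _).2 h0
    · intro i
      rw [← List.isChain_reverse] at hc
      have := List.isChain_iff_getElem.1 hc i (by omega)
      exact adj_symm this
    · intro i j hij
      have := (List.nodup_reverse.2 hn).getElem_inj_iff.1 hij
      exact Fin.ext this
    · rw [List.reverse_eq_iff]
      refine List.ext_getElem (by simp [hl]) fun i _ _ => ?_
      rw [List.getElem_ofFn]
      rfl

theorem gf_walks : gf x walks = ∑' n, (brickSawCount n : ℝ≥0∞) * x ^ (n + 1) := by
  rw [gf_eq_tsum_length, tsum_eq_zero_add' ENNReal.summable]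
  have h0 : {l | l ∈ walks ∧ l.length = 0} = ∅ := by
    ext l
    simp only [walks, Set.mem_ofPred_eq, Set.mem_empty_iff_false, iff_false, not_and,
      List.length_eq_zero_iff]
    rintro ⟨-, h⟩ rfl
    simp at h
  rw [h0]
  simp only [Set.encard_empty, brickSawCount_eq]
  simp only [← (finite_walks _).cast_ncard_eq]
  simp

end GeneratingFunction

/-- The critical weight, as an extended nonnegative real. -/
noncomputable def critX : ℝ≥0∞ := ENNReal.ofReal xc

theorem critX_pos : 0 < critX := ENNReal.ofReal_pos.2 xc_pos

theorem critX_ne_zero : critX ≠ 0 := critX_pos.ne'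

theorem critX_ne_top : critX ≠ ∞ := ENNReal.ofReal_ne_top

theorem two_cos_eq : 2 * Real.cos (Real.pi / 8) = Real.sqrt (2 + Real.sqrt 2) := by
  rw [Real.cos_pi_div_eight]
  ring

theorem xc_inv : xc⁻¹ = Real.sqrt (2 + Real.sqrt 2) := by
  rw [xc, inv_inv, two_cos_eq]

theorem xc_le_one : xc ≤ 1 := by
  rw [← inv_inv xc, xc_inv]
  refine inv_le_one_of_one_le₀ (Real.one_le_sqrt.2 ?_)
  linarith [Real.sqrt_nonneg 2]

theorem critX_le_one : critX ≤ 1 := ENNReal.ofReal_le_one.2 xc_le_one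

/-- The bridges of height `T`. -/
def bridges (T : ℕ) : Set (List (ℤ × ℤ)) := {l | IsBridge T l}

/-- The returns in the strip of height `T`. -/
def returns (T : ℕ) : Set (List (ℤ × ℤ)) := {l | IsReturn T l}

theorem gf_bridges_le {T : ℕ} (hT : 1 ≤ T) : gf critX (bridges T) ≤ critX := by
  rw [gf, ENNReal.tsum_eq_iSup_sum]
  refine iSup_le fun F => ?_
  have h := sum_bridges_le hT (F.map (Function.Embedding.subtype _)) fun l hl => by
    obtain ⟨l, -, rfl⟩ := Finset.mem_map.1 hl
    exact l.2
  rw [Finset.sum_map] at h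
  calc ∑ l ∈ F, critX ^ l.1.length = ENNReal.ofReal (∑ l ∈ F, xc ^ l.1.length) := by
        rw [ENNReal.ofReal_sum_of_nonneg fun _ _ => pow_nonneg xc_pos.le _]
        exact Finset.sum_congr rfl fun l _ => (ENNReal.ofReal_pow xc_pos.le _).symm
    _ ≤ critX := ENNReal.ofReal_le_ofReal h

theorem IsBridge.le_length {T : ℕ} {l : List (ℤ × ℤ)} (h : IsBridge T l) : T ≤ l.length := by
  obtain ⟨h, u, hu, huT, -⟩ := h
  have := (h.abs_le (List.mem_of_head? hu)).2
  rw [huT, abs_lt] at this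
  omega

theorem gf_bridges_le_pow {T : ℕ} (hT : 1 ≤ T) {x : ℝ≥0∞} (hx : x ≤ critX) :
    gf x (bridges T) ≤ (x / critX) ^ T := by
  have h1 : x / critX ≤ 1 := ENNReal.div_le_of_le_mul (by simpa using hx)
  have h2 : x = x / critX * critX := (ENNReal.div_mul_cancel critX_ne_zero critX_ne_top).symm
  calc gf x (bridges T) ≤ ∑' l : bridges T, (x / critX) ^ T * critX ^ l.1.length := by
        refine ENNReal.tsum_le_tsum fun l => ?_
        conv_lhs => rw [h2, mul_pow]
        exact mul_le_mul_left (pow_le_pow_right_of_le_one' h1 l.2.le_length) _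
    _ = (x / critX) ^ T * gf critX (bridges T) := ENNReal.tsum_mul_left
    _ ≤ (x / critX) ^ T * 1 := by
        gcongr
        exact (gf_bridges_le hT).trans critX_le_one
    _ = _ := mul_one _

theorem IsArc.mem_walks {D : ℤ × ℤ → Prop} {l : List (ℤ × ℤ)} (h : IsArc D l) : l ∈ walks := by
  refine ⟨h.2.1, ?_⟩
  obtain ⟨m, rfl⟩ := h.1
  simp

theorem card_arcs_le {D : ℤ × ℤ → Prop} (hs : D (0, 1)) (n : ℕ) :
    (arcs D n).card ≤ brickSawCount (n + 1) := by
  rw [brickSawCount_eq, ← Set.ncard_coe_finset]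
  refine Set.ncard_le_ncard (fun l hl => ?_) (finite_walks _)
  obtain ⟨h, hl⟩ := (mem_arcs hs).1 hl
  exact ⟨h.mem_walks, hl⟩

theorem abs_observable_le {D : ℤ × ℤ → Prop} (hs : D (0, 1)) (n : ℕ) :
    |observable D n| ≤ xc⁻¹ ^ 2 * (brickSawCount (n + 1) * xc ^ (n + 2)) := by
  have hx := xc_pos
  calc |observable D n| ≤ ∑ l ∈ arcs D n, |xc ^ n * phase (winding l)| :=
        Finset.abs_sum_le_sum_abs _ _
    _ ≤ ∑ l ∈ arcs D n, xc ^ n := by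
        refine Finset.sum_le_sum fun l _ => ?_
        rw [abs_mul, abs_of_pos (pow_pos hx n)]
        exact mul_le_of_le_one_right (pow_pos hx n).le (Real.abs_cos_le_one _)
    _ = (arcs D n).card * xc ^ n := by rw [Finset.sum_const, nsmul_eq_mul]
    _ ≤ brickSawCount (n + 1) * xc ^ n := by
        gcongr
        exact card_arcs_le hs n
    _ = _ := by
        field_simp
        ring

theorem tendsto_observable {D : ℤ × ℤ → Prop} (hs : D (0, 1)) (hZ : gf critX walks ≠ ∞) :
    Tendsto (observable D) atTop (𝓝 0) := by
  rw [gf_walks] at hZ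
  have h1 := ENNReal.tendsto_atTop_zero_of_tsum_ne_top hZ
  have h2 : Tendsto (fun n => (brickSawCount n : ℝ) * xc ^ (n + 1)) atTop (𝓝 0) := by
    have := (ENNReal.tendsto_toReal ENNReal.zero_ne_top).comp h1
    refine this.congr fun n => ?_
    simp [critX, xc_pos.le]
  have h3 := (h2.comp (tendsto_add_atTop_nat 1)).const_mul (xc⁻¹ ^ 2)
  rw [mul_zero] at h3
  exact squeeze_zero_norm (fun n => abs_observable_le hs n) h3

theorem cos_three_pi_div_eight_pos : 0 < Real.cos (3 * Real.pi / 8) :=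
  Real.cos_pos_of_mem_Ioo ⟨by linarith [Real.pi_pos], by linarith [Real.pi_pos]⟩

theorem gf_bridges_add_gf_returns {T : ℕ} (hT : 1 ≤ T) (hZ : gf critX walks ≠ ∞) :
    gf critX (bridges T) + ENNReal.ofReal (Real.cos (3 * Real.pi / 8)) * gf critX (returns T) =
      critX := by
  classical
  have hs : strip T (0, 1) := by simp [strip]; omega
  have hc := cos_three_pi_div_eight_pos
  have hx := xc_pos
  set c := Real.cos (3 * Real.pi / 8)
  let f : List (ℤ × ℤ) → ℝ := fun l =>
    (if IsBridge T l then 1 else 0) + (if IsReturn T l then c else 0)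
  have hf : ∀ l, 0 ≤ f l := fun l => by
    simp only [f]
    split_ifs <;> positivity
  have hflux : ∀ k, 0 ≤ flux (strip T) k := fun k => by
    rw [flux_strip hT]
    exact Finset.sum_nonneg fun l _ => mul_nonneg (by positivity) (hf l)
  have hsum : HasSum (flux (strip T)) 1 := by
    rw [hasSum_iff_tendsto_nat_of_nonneg hflux]
    have := (tendsto_observable hs hZ).const_sub 1
    rw [sub_zero] at this
    exact this.congr fun n => by linarith [sum_flux_add_observable hs (fun v hv => hv.1) n]
  let F : List (ℤ × ℤ) → ℝ≥0∞ := fun l => critX ^ l.length * ENNReal.ofReal (f l)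
  have h1 : gf critX (bridges T) + ENNReal.ofReal c * gf critX (returns T) = ∑' l, F l := by
    rw [gf, gf, ← ENNReal.tsum_mul_left, tsum_subtype (bridges T) fun l => critX ^ l.length,
      tsum_subtype (returns T) fun l => ENNReal.ofReal c * critX ^ l.length,
      ← ENNReal.tsum_add]
    refine tsum_congr fun l => ?_
    simp only [Set.indicator, F, f, bridges, returns, Set.mem_ofPred_eq]
    rw [ENNReal.ofReal_add (by split_ifs <;> positivity) (by split_ifs <;> positivity), mul_add]
    by_cases hb : IsBridge T l <;> by_cases hr : IsReturn T l <;> simp [hb, hr, mul_comm]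
  let g : (Σ k, arcs (strip T) k) → List (ℤ × ℤ) := fun p => p.2
  have hg : Function.Injective g := by
    rintro ⟨k, l, hl⟩ ⟨k', l', hl'⟩ (rfl : l = l')
    have e1 := ((mem_arcs hs).1 hl).2
    have e2 := ((mem_arcs hs).1 hl').2
    obtain rfl : k = k' := by omega
    rfl
  have hsupp : Function.support F ⊆ Set.range g := by
    intro l hl
    have harc : IsArc (strip T) l := by
      by_contra h
      refine hl ?_
      simp [F, f, IsBridge, IsReturn, h]
    have h2 := harc.1.length_le
    simp only [List.length_cons, List.length_nil] at h2
    exact ⟨⟨l.length - 2, l, (mem_arcs hs).2 ⟨harc, by omega⟩⟩, rfl⟩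
  have h2 : ∀ k, ∑' l : arcs (strip T) k, F l = ENNReal.ofReal (xc * flux (strip T) k) := by
    intro k
    rw [Finset.tsum_subtype, flux_strip hT, Finset.mul_sum, ENNReal.ofReal_sum_of_nonneg
      fun l _ => mul_nonneg hx.le (mul_nonneg (by positivity) (hf l))]
    refine Finset.sum_congr rfl fun l hl => ?_
    rw [← mul_assoc, ← pow_succ', ENNReal.ofReal_mul (by positivity), ENNReal.ofReal_pow hx.le,
      ← ((mem_arcs hs).1 hl).2]
    rfl
  rw [h1, ← hg.tsum_eq hsupp, ENNReal.tsum_sigma']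
  simp only [g, h2]
  rw [← ENNReal.ofReal_tsum_of_nonneg (fun k => mul_nonneg hx.le (hflux k))
    (hsum.summable.mul_left _), (hsum.mul_left xc).tsum_eq, mul_one, critX]

theorem IsSAW.map {σ : ℤ × ℤ → ℤ × ℤ} (hσ : ∀ u v, BrickAdj u v → BrickAdj (σ u) (σ v))
    (hinj : Function.Injective σ) {l : List (ℤ × ℤ)} (h : IsSAW l) : IsSAW (l.map σ) :=
  ⟨(List.isChain_map σ).2 (h.1.imp fun {u v} => hσ u v), h.2.map hinj⟩

theorem IsSAW.reverse {l : List (ℤ × ℤ)} (h : IsSAW l) : IsSAW l.reverse :=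
  ⟨List.isChain_reverse.2 (h.1.imp fun {_ _} => adj_symm), List.nodup_reverse.2 h.2⟩

theorem IsSAW.left {l m : List (ℤ × ℤ)} (h : IsSAW (l ++ m)) : IsSAW l :=
  ⟨(List.isChain_append.1 h.1).1, (List.nodup_append.1 h.2).1⟩

theorem IsSAW.right {l m : List (ℤ × ℤ)} (h : IsSAW (l ++ m)) : IsSAW m :=
  ⟨(List.isChain_append.1 h.1).2.1, (List.nodup_append.1 h.2).2.1⟩

theorem IsSAW.init {l m : List (ℤ × ℤ)} {v : ℤ × ℤ} (h : IsSAW (l ++ v :: m)) :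
    IsSAW (l ++ [v]) := by
  rw [List.append_cons] at h
  exact h.left

theorem adj_add {c : ℤ × ℤ} (hc : Even (c.1 + c.2)) (u v : ℤ × ℤ) (h : BrickAdj u v) :
    BrickAdj (u + c) (v + c) := by
  simp only [BrickAdj, Prod.fst_add, Prod.snd_add, Int.even_iff] at *
  omega

theorem adj_sub {c : ℤ × ℤ} (hc : ¬ Even (c.1 + c.2)) (u v : ℤ × ℤ) (h : BrickAdj u v) :
    BrickAdj (c - u) (c - v) := by
  simp only [BrickAdj, Prod.fst_sub, Prod.snd_sub, Int.even_iff] at *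
  omega

open Classical in
/-- A symmetry of the lattice moving the origin to `v`. -/
noncomputable def shift (v u : ℤ × ℤ) : ℤ × ℤ := if Even (v.1 + v.2) then u + v else v - u

open Classical in
/-- The inverse of `shift v`. -/
noncomputable def unshift (v u : ℤ × ℤ) : ℤ × ℤ := if Even (v.1 + v.2) then u + -v else v - u

theorem shift_unshift (v u : ℤ × ℤ) : shift v (unshift v u) = u := by
  simp only [shift, unshift]
  split_ifs <;> simp

theorem unshift_self (v : ℤ × ℤ) : unshift v v = (0, 0) := by
  simp only [unshift]
  split_ifs <;> simp [Prod.ext_iff]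

theorem unshift_injective (v : ℤ × ℤ) : Function.Injective (unshift v) :=
  Function.LeftInverse.injective (shift_unshift v)

theorem adj_unshift (v u w : ℤ × ℤ) (h : BrickAdj u w) : BrickAdj (unshift v u) (unshift v w) := by
  simp only [unshift]
  split_ifs with hv
  · exact adj_add (by simpa [← neg_add_rev, add_comm] using hv) u w h
  · exact adj_sub hv u w h

/-- The walks with `n` steps. -/
def walksOf (n : ℕ) : Set (List (ℤ × ℤ)) := {l | l ∈ walks ∧ l.length = n + 1}

theorem gf_walksOf (x : ℝ≥0∞) (n : ℕ) : gf x (walksOf n) = brickSawCount n * x ^ (n + 1) := by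
  have h : gf x (walksOf n) = ∑' _ : walksOf n, x ^ (n + 1) :=
    tsum_congr fun l => by rw [l.2.2]
  rw [h, ENNReal.tsum_set_const, brickSawCount_eq, walksOf, ← (finite_walks n).cast_ncard_eq]
  simp

theorem brickSawCount_add_le (m n : ℕ) :
    brickSawCount (m + n) ≤ brickSawCount m * brickSawCount n := by
  have h := gf_mul_le (x := 1) (S := walksOf (m + n)) (P := walksOf m) (Q := walksOf n) 1
    (fun a b => (a.map (shift (b.headD (0, 0)))).dropLast ++ b) fun l hl => by
      obtain ⟨⟨hl, h0⟩, hlen⟩ := hl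
      have hd : (l.drop m).length = n + 1 := by simp; omega
      obtain ⟨v, b, hb⟩ := List.exists_cons_of_length_eq_add_one hd
      have hl' : l = l.take m ++ v :: b := by rw [← hb, List.take_append_drop]
      have hm : (l.take m).length = m := by simp; omega
      rw [hb] at hd
      generalize l.take m = r at hl' hm
      subst hl'
      refine ⟨(r ++ [v]).map (unshift v), ⟨⟨IsSAW.map (adj_unshift v) (unshift_injective v)
        hl.init, ?_⟩, ?_⟩, v :: b, ⟨⟨hl.right, ?_⟩, hd⟩, ?_, ?_⟩
      · simp [unshift_self]
      · simp [hm]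
      · simpa [List.getLast?_append] using h0
      · simp [shift_unshift, Function.comp_def]
      · simp [hm]
        omega
  simp only [gf_walksOf, one_pow, mul_one, one_mul] at h
  exact_mod_cast h

theorem IsArc.right {D : ℤ × ℤ → Prop} {r b : List (ℤ × ℤ)} {u : ℤ × ℤ}
    (h : IsArc D (r ++ u :: b)) (hu : u ≠ (0, 0)) : IsArc D (u :: b) := by
  have hb : b ≠ [] := by
    rintro rfl
    have := getLast_of_suffix h.1 (by simp)
    exact hu (by simpa using this)
  obtain ⟨t, b, rfl⟩ := List.exists_cons_of_ne_nil hb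
  induction r with
  | nil => exact h
  | cons w r ih =>
    refine ih ?_
    cases r with
    | nil => exact h.tail
    | cons a r => cases r <;> exact h.tail

theorem IsArc.left {D : ℤ × ℤ → Prop} {r b : List (ℤ × ℤ)} {u : ℤ × ℤ}
    (h : IsArc D (r ++ u :: b)) (hu : u ≠ (0, 0)) : ∀ y ∈ r ++ [u], D y := by
  have h0 : (0, 0) ∈ u :: b := by
    have := getLast_of_suffix h.1 (by simp)
    rw [List.getLast_append_of_right_ne_nil _ _ (List.cons_ne_nil _ _)] at this
    exact this ▸ List.getLast_mem _
  intro y hy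
  rw [List.mem_append, List.mem_singleton] at hy
  refine h.2.2 y ?_ ?_
  · rw [List.mem_append, List.mem_cons]
    tauto
  · rintro rfl
    rcases hy with hy | hy
    · exact (List.nodup_append.1 h.2.1.2).2.2 _ hy _ h0 rfl
    · exact hu hy.symm

theorem isArc_append {D : ℤ × ℤ → Prop} (hDU : ∀ v, D v → Upper v) {m : List (ℤ × ℤ)}
    (h : IsSAW m) (hlast : m.getLast? = some (0, 1)) (hD : ∀ v ∈ m, D v) :
    IsArc D (m ++ [(0, 0)]) := by
  refine ⟨?_, ⟨?_, ?_⟩, ?_⟩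
  · obtain ⟨m, rfl⟩ := List.getLast?_eq_some_iff.1 hlast
    simp
  · refine List.isChain_append.2 ⟨h.1, by simp, fun u hu v hv => ?_⟩
    rw [hlast] at hu
    simp only [Option.mem_def, Option.some.injEq, List.head?_cons] at hu hv
    subst hu hv
    simp [BrickAdj]
  · refine List.nodup_append.2 ⟨h.2, by simp, fun u hu v hv => ?_⟩
    rintro rfl
    have := hDU u (hD u hu)
    simp only [List.mem_singleton] at hv
    subst hv
    simp [Upper] at this
  · intro v hv h0
    rw [List.mem_append, List.mem_singleton] at hv
    exact hD v (hv.resolve_right h0)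

theorem eq_vert_of_adj {u v : ℤ × ℤ} (h : BrickAdj v u) (hne : u.2 ≠ v.2) : u = vert v := by
  simp only [BrickAdj, Int.even_iff] at h
  simp only [vert, Int.even_iff]
  split_ifs <;> ext <;> simp <;> omega

/-- A vertex of a walk whose adjacent end-steps are horizontal has a horizontal neighbour. -/
theorem exists_horizontal {l : List (ℤ × ℤ)} (h : IsSAW l) (hlen : 2 ≤ l.length) {v : ℤ × ℤ}
    (hv : v ∈ l) (h1 : ∀ t m, l = v :: t :: m → t.2 = v.2)
    (h2 : ∀ t m, l = m ++ [t, v] → t.2 = v.2) : ∃ w ∈ l, BrickAdj v w ∧ w.2 = v.2 := by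
  obtain ⟨A, B, rfl⟩ := List.append_of_mem hv
  have hc := List.isChain_append.1 h.1
  rcases List.eq_nil_or_concat A with rfl | ⟨A, a, rfl⟩
  · match B, hlen with
    | t :: B, _ =>
      exact ⟨t, by simp, (List.isChain_cons_cons.1 h.1).1, h1 t B rfl⟩
  · have ha : BrickAdj v a := adj_symm (hc.2.2 a (by simp) v (by simp))
    match B with
    | [] => exact ⟨a, by simp, ha, h2 a A (by simp)⟩
    | b :: B =>
      have hb : BrickAdj v b := (List.isChain_cons_cons.1 hc.2.1).1
      by_contra! hcon
      have ea := eq_vert_of_adj ha (hcon a (by simp) ha)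
      have eb := eq_vert_of_adj hb (hcon b (by simp) hb)
      exact (List.nodup_append.1 h.2).2.2 a (by simp) b (by simp) (ea.trans eb.symm)

theorem returns_subset (T : ℕ) : returns (T + 1) ⊆
    returns T ∪ {l | IsReturn (T + 1) l ∧ ∃ v ∈ l, v.2 = T + 1} := by
  intro l hl
  by_cases h : ∃ v ∈ l, v.2 = T + 1
  · exact .inr ⟨hl, h⟩
  · push Not at h
    refine .inl ⟨⟨hl.1.1, hl.1.2.1, fun v hv h0 => ?_⟩, hl.2⟩
    have h1 := hl.1.2.2 v hv h0
    have h2 := h v hv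
    simp only [strip] at h1 ⊢
    push_cast at h1
    omega

theorem gf_returns_cut_le {T : ℕ} (hT : 1 ≤ T) (x : ℝ≥0∞) :
    x ^ 2 * gf x {l | IsReturn (T + 1) l ∧ ∃ v ∈ l, v.2 = T + 1} ≤
      gf x (bridges (T + 1)) * gf x (bridges (T + 1)) := by
  refine gf_mul_le 2 (fun a b => (a.dropLast.tail.map
    fun u => u + (b.headD (0, 0) - a.headD (0, 0))).reverse ++ b) ?_
  rintro l ⟨⟨harc, w, hw, hw1, hwo, hw0⟩, v, hv, hvT⟩
  have hlen := harc.1.length_le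
  simp only [List.length_cons, List.length_nil] at hlen
  obtain ⟨u, hu, huT, hue⟩ : ∃ u ∈ l, u.2 = T + 1 ∧ Even (u.1 + u.2) := by
    by_cases hve : Even (v.1 + v.2)
    · exact ⟨v, hv, hvT, hve⟩
    · obtain ⟨u, hu, huv, hu2⟩ := exists_horizontal harc.2.1 hlen hv
        (by
          rintro t m rfl
          obtain rfl : v = w := by simpa using hw
          omega)
        (by
          rintro t m rfl
          have := getLast_of_suffix harc.1 (by simp)
          simp at this
          simp [this] at hvT
          omega)
      refine ⟨u, hu, by omega, ?_⟩
      simp only [BrickAdj, Int.even_iff] at huv hve ⊢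
      omega
  have hune : u ≠ (0, 0) := by
    rintro rfl
    simp at huT
    omega
  obtain ⟨r, b, rfl⟩ := List.append_of_mem hu
  have hr : r ≠ [] := by
    rintro rfl
    obtain rfl : u = w := by simpa using hw
    exact hwo hue
  obtain ⟨w', r, rfl⟩ := List.exists_cons_of_ne_nil hr
  obtain rfl : w' = w := by simpa using hw
  have hb := harc.right hune
  have hstrip := harc.left hune
  have hc : Even ((-w' + (0, 1)).1 + (-w' + (0, 1)).2) := by
    simp only [Int.even_iff, Prod.fst_add, Prod.snd_add, Prod.fst_neg, Prod.snd_neg] at hwo ⊢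
    omega
  have hsaw : IsSAW ((w' :: r ++ [u]).reverse.map (· + (-w' + (0, 1)))) := by
    refine IsSAW.map (adj_add hc) (add_left_injective _) harc.2.1.init.reverse
  refine ⟨(w' :: r ++ [u]).reverse.map (· + (-w' + (0, 1))) ++ [(0, 0)], ⟨isArc_append
    (fun v hv => hv.1) hsaw ?_ ?_, u + (-w' + (0, 1)), by simp, ?_, ?_⟩, u :: b,
    ⟨hb, u, by simp, by simpa using huT, hue⟩, ?_, ?_⟩
  · rw [List.reverse_append, List.reverse_cons]
    simp [List.getLast?_cons]
  · intro y hy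
    obtain ⟨z, hz, rfl⟩ := List.mem_map.1 hy
    have := hstrip z (List.mem_reverse.1 hz)
    simp only [strip, Prod.snd_add, Prod.snd_neg] at this ⊢
    omega
  · simp only [Prod.snd_add, Prod.snd_neg]
    push_cast
    omega
  · simp only [Int.even_iff, Prod.fst_add, Prod.snd_add, Prod.fst_neg, Prod.snd_neg] at hue hc ⊢
    omega
  · generalize -w' + (0, 1) = c
    rw [List.reverse_append, List.map_append, List.reverse_singleton, List.map_singleton,
      List.singleton_append, List.dropLast_concat, List.tail_cons, List.map_map]
    have hid : ((fun y => y + ((u :: b).headD (0, 0) -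
        ((u + c) :: ((w' :: r).reverse.map (· + c)) ++ [(0, 0)]).headD (0, 0))) ∘ (· + c)) =
        id := by
      funext y
      simp
    rw [hid, List.map_id, List.reverse_reverse]
  · simp
    omega

theorem not_summable_of_le_mul {b : ℕ → ℝ} {K : ℝ} (hK : 0 ≤ K) (hb : ∀ n, 0 ≤ b n)
    (h0 : 0 < b 0) (h : ∀ n, b n ≤ b (n + 1) * (1 + K * b (n + 1))) : ¬ Summable b := by
  intro hs
  have h1 : ∀ n, b 0 ≤ b n * Real.exp (K * ∑ i ∈ Finset.range n, b (i + 1)) := by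
    intro n
    induction n with
    | zero => simp
    | succ n ih =>
      refine ih.trans ?_
      rw [Finset.sum_range_succ, mul_add, add_comm (K * _), Real.exp_add, ← mul_assoc]
      refine mul_le_mul_of_nonneg_right ((h n).trans ?_) (Real.exp_pos _).le
      refine mul_le_mul_of_nonneg_left ?_ (hb _)
      rw [add_comm]
      exact Real.add_one_le_exp _
  have hs1 : Summable fun i => b (i + 1) := (summable_nat_add_iff 1).2 hs
  have h2 : ∀ n, b 0 ≤ b n * Real.exp (K * ∑' i, b (i + 1)) := fun n => (h1 n).trans <| by
    refine mul_le_mul_of_nonneg_left (Real.exp_le_exp.2 ?_) (hb n)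
    exact mul_le_mul_of_nonneg_left (hs1.sum_le_tsum _ fun i _ => hb _) hK
  have h3 := hs.tendsto_atTop_zero.mul_const (Real.exp (K * ∑' i, b (i + 1)))
  rw [zero_mul] at h3
  exact h0.not_ge (ge_of_tendsto' h3 h2)

theorem summable_of_add_le {t : ℕ → ℝ} (ht : ∀ n, 0 ≤ t n) {m : ℕ} (hm : t m < 1)
    (h : ∀ n, t (m + n) ≤ t m * t n) : Summable t := by
  refine summable_of_sum_range_le (c := (∑ n ∈ Finset.range m, t n) / (1 - t m)) ht fun N => ?_
  rw [le_div_iff₀ (by linarith)]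
  have h1 : ∑ n ∈ Finset.range N, t n ≤ ∑ n ∈ Finset.range (m + N), t n :=
    Finset.sum_le_sum_of_subset_of_nonneg (Finset.range_mono (by omega)) fun _ _ _ => ht _
  rw [Finset.sum_range_add] at h1
  have h2 : ∑ n ∈ Finset.range N, t (m + n) ≤ t m * ∑ n ∈ Finset.range N, t n := by
    rw [Finset.mul_sum]
    exact Finset.sum_le_sum fun n _ => h n
  linarith

theorem gf_walks_ne_top {m : ℕ} (hm : brickSawCount m * xc ^ m < 1) :
    gf critX walks ≠ ∞ := by
  have hx := xc_pos
  have hs : Summable fun n => (brickSawCount n : ℝ) * xc ^ n := by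
    refine summable_of_add_le (fun n => by positivity) hm fun n => ?_
    calc (brickSawCount (m + n) : ℝ) * xc ^ (m + n)
        ≤ (brickSawCount m * brickSawCount n : ℕ) * xc ^ (m + n) := by
          gcongr
          exact brickSawCount_add_le m n
      _ = _ := by
          push_cast
          ring
  have h : gf critX walks = ∑' n, ENNReal.ofReal (xc * (brickSawCount n * xc ^ n)) := by
    rw [gf_walks]
    refine tsum_congr fun n => ?_
    rw [mul_left_comm, ← pow_succ', ENNReal.ofReal_mul (by positivity), ENNReal.ofReal_natCast,
      ENNReal.ofReal_pow hx.le, critX]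
  rw [h, ← ENNReal.ofReal_tsum_of_nonneg (fun n => by positivity) (hs.mul_left xc)]
  exact ENNReal.ofReal_ne_top

theorem tsum_gf_bridges_le (x : ℝ≥0∞) : ∑' T, gf x (bridges T) ≤ gf x walks := by
  let g : (Σ T, bridges T) → walks := fun p => ⟨p.2, p.2.2.1.mem_walks⟩
  have hg : Function.Injective g := by
    rintro ⟨T, l, hl⟩ ⟨T', l', hl'⟩ h
    obtain rfl : l = l' := congrArg Subtype.val h
    obtain ⟨-, u, hu, huT, -⟩ := hl
    obtain ⟨-, v, hv, hvT, -⟩ := hl'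
    obtain rfl : u = v := by simpa [Option.mem_def.1 hu] using hv
    obtain rfl : T = T' := by exact_mod_cast huT.symm.trans hvT
    rfl
  have := ENNReal.tsum_comp_le_tsum_of_injective hg fun l : walks => x ^ l.1.length
  rwa [ENNReal.tsum_sigma'] at this

theorem bridge_one_mem : [((1 : ℤ), (1 : ℤ)), (0, 1), (0, 0)] ∈ bridges 1 := by
  refine ⟨⟨by simp, ⟨by simp [BrickAdj], by simp⟩, by simp [strip]⟩, (1, 1), by simp, by simp, ?_⟩
  decide

theorem gf_walks_eq_top : gf critX walks = ∞ := by
  by_contra hZ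
  have hx := xc_pos
  have hc := cos_three_pi_div_eight_pos
  have hbZ : ∀ T, gf critX (bridges T) ≠ ∞ := fun T =>
    ne_top_of_le_ne_top hZ (gf_mono fun l hl => hl.1.mem_walks)
  have haZ : ∀ T, gf critX (returns T) ≠ ∞ := fun T =>
    ne_top_of_le_ne_top hZ (gf_mono fun l hl => hl.1.mem_walks)
  set c := Real.cos (3 * Real.pi / 8) with hcdef
  let b : ℕ → ℝ := fun T => (gf critX (bridges (T + 1))).toReal
  let a : ℕ → ℝ := fun T => (gf critX (returns (T + 1))).toReal
  have hba : ∀ T, b T + c * a T = xc := by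
    intro T
    have h := congrArg ENNReal.toReal (gf_bridges_add_gf_returns (Nat.succ_pos T) hZ)
    rw [ENNReal.toReal_add (hbZ _) (ENNReal.mul_ne_top ENNReal.ofReal_ne_top (haZ _)),
      ENNReal.toReal_mul, ENNReal.toReal_ofReal hc.le, critX, ENNReal.toReal_ofReal hx.le] at h
    exact h
  have ha : ∀ T, xc ^ 2 * a (T + 1) ≤ xc ^ 2 * a T + b (T + 1) * b (T + 1) := by
    intro T
    have h : critX ^ 2 * gf critX (returns (T + 1 + 1)) ≤
        critX ^ 2 * gf critX (returns (T + 1)) +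
          gf critX (bridges (T + 1 + 1)) * gf critX (bridges (T + 1 + 1)) := by
      refine (mul_le_mul_right ((gf_mono (returns_subset (T + 1))).trans gf_union_le) _).trans ?_
      rw [mul_add]
      exact add_le_add le_rfl (gf_returns_cut_le (Nat.succ_pos T) critX)
    have h' := ENNReal.toReal_mono (ENNReal.add_ne_top.2 ⟨ENNReal.mul_ne_top
      (ENNReal.pow_ne_top critX_ne_top) (haZ _), ENNReal.mul_ne_top (hbZ _) (hbZ _)⟩) h
    rw [ENNReal.toReal_add (ENNReal.mul_ne_top (ENNReal.pow_ne_top critX_ne_top) (haZ _))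
      (ENNReal.mul_ne_top (hbZ _) (hbZ _))] at h'
    simpa [ENNReal.toReal_mul, ENNReal.toReal_pow, critX, hx.le, a, b] using h'
  have hs : Summable b := by
    have h1 : ∑' T, gf critX (bridges T) ≠ ∞ := ne_top_of_le_ne_top hZ (tsum_gf_bridges_le critX)
    exact (summable_nat_add_iff 1).2 (ENNReal.summable_toReal h1)
  refine not_summable_of_le_mul (K := c / xc ^ 2) (by positivity)
    (fun n => ENNReal.toReal_nonneg) ?_ (fun n => ?_) hs
  · exact ENNReal.toReal_pos ((ENNReal.pow_pos critX_pos _).trans_le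
      (le_gf bridge_one_mem)).ne' (hbZ _)
  · have h1 := hba n
    have h2 := hba (n + 1)
    have h3 := ha n
    have h4 : a (n + 1) ≤ a n + b (n + 1) * b (n + 1) / xc ^ 2 := by
      rw [← sub_le_iff_le_add', le_div_iff₀ (by positivity)]
      linarith
    have h5 := mul_le_mul_of_nonneg_left h4 hc.le
    have h6 : b (n + 1) * (1 + c / xc ^ 2 * b (n + 1)) =
        b (n + 1) + c * (b (n + 1) * b (n + 1) / xc ^ 2) := by ring
    rw [h6]
    linarith

theorem one_le_brickSawCount_mul_pow (n : ℕ) : 1 ≤ brickSawCount n * xc ^ n := by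
  by_contra! h
  exact gf_walks_ne_top h gf_walks_eq_top

/-- The last step of the walk `l`, if any, is horizontal. -/
def HeadHorizontal (l : List (ℤ × ℤ)) : Prop := ∀ u t m, l = u :: t :: m → t.2 = u.2

/-- The arcs in the strip of height `T` that end with a horizontal step. -/
def horArcs (T : ℕ) : Set (List (ℤ × ℤ)) := {l | IsArc (strip T) l ∧ HeadHorizontal l}

theorem horArcs_zero : horArcs 0 = ∅ := by
  rw [Set.eq_empty_iff_forall_notMem]
  rintro l ⟨h, -⟩
  have := h.2.2 (0, 1) (h.1.subset (by simp)) (by simp)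
  simp [strip] at this

/-- The reflection of the lattice in a horizontal line that moves the origin to `a`. -/
def flip (a v : ℤ × ℤ) : ℤ × ℤ := (v.1 + a.1, a.2 - v.2)

/-- The inverse of `flip a`. -/
def unflip (a v : ℤ × ℤ) : ℤ × ℤ := (v.1 - a.1, a.2 - v.2)

theorem flip_unflip (a v : ℤ × ℤ) : flip a (unflip a v) = v := by
  simp [flip, unflip]

theorem adj_unflip {a : ℤ × ℤ} (ha : ¬ Even (a.1 + a.2)) (u v : ℤ × ℤ) (h : BrickAdj u v) :
    BrickAdj (unflip a u) (unflip a v) := by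
  simp only [BrickAdj, unflip, Int.even_iff] at *
  omega

/-- Continues the walk `b` by a reflected copy of `h` that starts next to the head of `b`. -/
def glue (s : ℤ) (h b : List (ℤ × ℤ)) : List (ℤ × ℤ) :=
  h.map (flip (b.headD (0, 0) + (s, 0))) ++ b

theorem exists_first {p : ℤ × ℤ → Prop} {l : List (ℤ × ℤ)} (h : ∃ v ∈ l, p v) :
    ∃ r u b, l = r ++ u :: b ∧ p u ∧ ∀ v ∈ r, ¬ p v := by
  induction l with
  | nil => simp at h
  | cons w l ih =>
    by_cases hw : p w
    · exact ⟨[], w, l, rfl, hw, by simp⟩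
    · obtain ⟨r, u, b, rfl, hu, hr⟩ := ih (by simpa [hw] using h)
      exact ⟨w :: r, u, b, rfl, hu, by simpa [hw] using hr⟩

theorem HeadHorizontal.left {l m : List (ℤ × ℤ)} (h : HeadHorizontal (l ++ m)) :
    HeadHorizontal l := by
  rintro u t m' rfl
  exact h u t (m' ++ m) rfl

/-- The part of an arc after its last visit to an even vertex of the top row of the strip. -/
theorem unflip_mem {T : ℕ} {r b : List (ℤ × ℤ)} {u a c : ℤ × ℤ}
    (h : r ++ c :: a :: u :: b ∈ horArcs (T + 1)) (huT : u.2 = T + 1) (hue : Even (u.1 + u.2))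
    (hr : ∀ v ∈ r ++ [c, a], ¬ (v.2 = T + 1 ∧ Even (v.1 + v.2))) (hau : a.2 = T + 1) :
    (r ++ [c, a]).map (unflip a) ∈ horArcs T := by
  obtain ⟨harc, hhor⟩ := h
  have hsaw := harc.2.1
  have hao : ¬ Even (a.1 + a.2) := fun he => hr a (by simp) ⟨hau, he⟩
  have heq : r ++ c :: a :: u :: b = (r ++ [c, a]) ++ u :: b := by simp
  rw [heq] at hsaw hhor harc
  have hs : IsSAW (r ++ [c, a]) := hsaw.left
  have hh : HeadHorizontal (r ++ [c, a]) := hhor.left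
  have hune : u ≠ (0, 0) := by
    rintro rfl
    simp at huT
    omega
  have hstrip : ∀ v ∈ r ++ [c, a], strip (T + 1) v := fun v hv =>
    harc.left hune v (List.mem_append_left _ hv)
  have hca : BrickAdj a c := by
    have := (List.isChain_append.1 hs.1).2.1
    exact adj_symm (List.isChain_cons_cons.1 this).1
  have hcv : c = vert a := by
    refine eq_vert_of_adj hca fun e => hr c (by simp) ⟨e.trans hau, ?_⟩
    simp only [BrickAdj, Int.even_iff] at hca hao ⊢
    omega
  have hrow : ∀ v ∈ r ++ [c, a], v ≠ a → v.2 ≤ T := by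
    intro v hv hva
    by_contra hvT
    have h1 := hstrip v hv
    have hvT : v.2 = T + 1 := by
      simp only [strip] at h1
      push_cast at h1
      omega
    obtain ⟨w, hw, hvw, hwv⟩ := exists_horizontal hs (by simp) hv
      (fun t m e => hh v t m e) fun t m e => by
        have := congrArg List.getLast? e
        simp at this
        exact absurd this.symm hva
    refine hr w hw ⟨hwv.trans hvT, ?_⟩
    have := hr v hv
    simp only [BrickAdj, Int.even_iff] at hvw this ⊢
    omega
  refine ⟨⟨?_, IsSAW.map (adj_unflip hao) (Function.LeftInverse.injective (flip_unflip a)) hs, ?_⟩,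
    ?_⟩
  · rw [List.map_append]
    convert List.suffix_append (r.map (unflip a)) _ using 1
    simp [hcv, vert, hao, unflip]
  · intro v hv hv0
    obtain ⟨w, hw, rfl⟩ := List.mem_map.1 hv
    have h1 := hrow w hw (by rintro rfl; simp [unflip] at hv0)
    have h2 := hstrip w hw
    simp only [strip, unflip] at h2 ⊢
    omega
  · intro v t m e
    match hl : r ++ [c, a], e with
    | v' :: t' :: m', e =>
      simp only [List.map_cons, List.cons.injEq] at e
      rw [← e.1, ← e.2.1, unflip, unflip, hh v' t' m' hl]

theorem horArcs_subset (T : ℕ) : horArcs (T + 1) ⊆ horArcs T ∪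
    (Set.image2 (glue 1) ({[]} ∪ {[(0, 0)]} ∪ horArcs T) (bridges (T + 1)) ∪
      Set.image2 (glue (-1)) ({[]} ∪ {[(0, 0)]} ∪ horArcs T) (bridges (T + 1))) := by
  intro l hl
  have harc := hl.1
  by_cases h : ∃ v ∈ l, v.2 = T + 1
  · right
    have hex : ∃ v ∈ l, v.2 = T + 1 ∧ Even (v.1 + v.2) := by
      obtain ⟨v, hv, hvT⟩ := h
      by_cases hve : Even (v.1 + v.2)
      · exact ⟨v, hv, hvT, hve⟩
      · obtain ⟨u, hu, huv, hu2⟩ := exists_horizontal harc.2.1 (by simpa using harc.1.length_le) hv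
          (fun t m e => hl.2 v t m e)
          (by
            rintro t m rfl
            have := getLast_of_suffix harc.1 (by simp)
            simp at this
            simp [this] at hvT
            omega)
        refine ⟨u, hu, by omega, ?_⟩
        simp only [BrickAdj, Int.even_iff] at huv hve ⊢
        omega
    obtain ⟨r, u, b, rfl, ⟨huT, hue⟩, hr⟩ := exists_first hex
    have hune : u ≠ (0, 0) := by
      rintro rfl
      simp at huT
      omega
    have hb : u :: b ∈ bridges (T + 1) := ⟨harc.right hune, u, by simp, by simpa using huT, hue⟩
    rcases List.eq_nil_or_concat r with rfl | ⟨r, a, rfl⟩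
    · exact .inl ⟨[], by simp, u :: b, hb, by simp [glue]⟩
    · have hau : BrickAdj u a :=
        adj_symm ((List.isChain_append.1 harc.2.1.1).2.2 a (by simp) u (by simp))
      have haT : a.2 = u.2 := by
        by_contra hne
        have h1 := eq_vert_of_adj hau hne
        have h2 := harc.left hune a (by simp)
        simp only [h1, vert, if_pos hue, strip] at h2
        push_cast at h2
        omega
      have key : ∃ h ∈ ({[]} ∪ {[(0, 0)]} ∪ horArcs T : Set (List (ℤ × ℤ))),
          h.map (flip a) = r ++ [a] := by
        rcases List.eq_nil_or_concat r with rfl | ⟨r, c, rfl⟩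
        · exact ⟨[(0, 0)], by simp, by simp [flip]⟩
        · simp only [List.concat_eq_append, List.append_assoc, List.cons_append,
            List.nil_append] at hl hr ⊢
          refine ⟨_, .inr (unflip_mem hl huT hue hr (haT.trans huT)), ?_⟩
          simp [flip_unflip, Function.comp_def]
      obtain ⟨h, hh, hha⟩ := key
      have hs : a = u + (1, 0) ∨ a = u + (-1, 0) := by
        simp only [BrickAdj] at hau
        simp only [Prod.ext_iff, Prod.fst_add, Prod.snd_add]
        omega
      rcases hs with hs | hs
      · exact .inl ⟨h, hh, u :: b, hb, by simp [glue, ← hs, hha]⟩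
      · exact .inr ⟨h, hh, u :: b, hb, by simp [glue, ← hs, hha]⟩
  · left
    push Not at h
    refine ⟨⟨harc.1, harc.2.1, fun v hv h0 => ?_⟩, hl.2⟩
    have h1 := harc.2.2 v hv h0
    have h2 := h v hv
    simp only [strip] at h1 ⊢
    push_cast at h1
    omega

theorem gf_image2_le {x : ℝ≥0∞} {P Q : Set (List (ℤ × ℤ))}
    (f : List (ℤ × ℤ) → List (ℤ × ℤ) → List (ℤ × ℤ))
    (hf : ∀ a ∈ P, ∀ b ∈ Q, (f a b).length = a.length + b.length) :
    gf x (Set.image2 f P Q) ≤ gf x P * gf x Q := by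
  have := gf_mul_le (x := x) (S := Set.image2 f P Q) 0 f fun l hl => by
    obtain ⟨a, ha, b, hb, rfl⟩ := hl
    exact ⟨a, ha, b, hb, rfl, hf a ha b hb⟩
  simpa using this

theorem gf_horArcs_succ_le {x : ℝ≥0∞} (hx : x ≤ 1) (T : ℕ) :
    1 + gf x (horArcs (T + 1)) ≤ (1 + gf x (horArcs T)) * (1 + 4 * gf x (bridges (T + 1))) := by
  set H := gf x (horArcs T)
  set B := gf x (bridges (T + 1))
  have hR : gf x ({[]} ∪ {[(0, 0)]} ∪ horArcs T) ≤ 2 * (1 + H) := by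
    calc gf x ({[]} ∪ {[(0, 0)]} ∪ horArcs T) ≤ gf x {[]} + gf x {[(0, 0)]} + H :=
          gf_union_le.trans (add_le_add gf_union_le le_rfl)
      _ ≤ 1 + 1 + (H + H) := by
          rw [gf_singleton, gf_singleton]
          refine add_le_add (add_le_add (by simp) (by simpa using hx)) le_self_add
      _ = _ := by ring
  have hG : ∀ s, gf x (Set.image2 (glue s) ({[]} ∪ {[(0, 0)]} ∪ horArcs T) (bridges (T + 1))) ≤
      2 * (1 + H) * B := fun s =>
    (gf_image2_le _ fun a _ b _ => by simp [glue]).trans (mul_le_mul_left hR _)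
  calc 1 + gf x (horArcs (T + 1)) ≤ 1 + (H + (2 * (1 + H) * B + 2 * (1 + H) * B)) := by
        refine add_le_add le_rfl ((gf_mono (horArcs_subset T)).trans (gf_union_le.trans ?_))
        exact add_le_add le_rfl (gf_union_le.trans (add_le_add (hG 1) (hG (-1))))
    _ = _ := by ring

theorem exists_gf_horArcs_le {y : ℝ} (hy0 : 0 ≤ y) (hy : y < xc) :
    ∃ K : ℝ≥0∞, K ≠ ∞ ∧ ∀ T, gf (ENNReal.ofReal y) (horArcs T) ≤ K := by
  have hx := xc_pos
  set q := y / xc with hq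
  have hq0 : 0 ≤ q := by positivity
  have hq1 : q < 1 := (div_lt_one hx).2 hy
  have hs : Summable fun i => 4 * q ^ (i + 1) :=
    ((summable_nat_add_iff 1).2 (summable_geometric_of_lt_one hq0 hq1)).mul_left 4
  have hx1 : ENNReal.ofReal y ≤ 1 := ENNReal.ofReal_le_one.2 (hy.le.trans xc_le_one)
  have hB : ∀ T, gf (ENNReal.ofReal y) (bridges (T + 1)) ≤ ENNReal.ofReal (q ^ (T + 1)) := by
    intro T
    refine (gf_bridges_le_pow (Nat.succ_pos T) (ENNReal.ofReal_le_ofReal hy.le)).trans_eq ?_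
    rw [critX, ← ENNReal.ofReal_div_of_pos hx, ENNReal.ofReal_pow hq0]
  have h1 : ∀ T, 1 + gf (ENNReal.ofReal y) (horArcs T) ≤
      ENNReal.ofReal (Real.exp (∑ i ∈ Finset.range T, 4 * q ^ (i + 1))) := by
    intro T
    induction T with
    | zero => simp [horArcs_zero, gf]
    | succ T ih =>
      rw [Finset.sum_range_succ, Real.exp_add, ENNReal.ofReal_mul (Real.exp_pos _).le]
      refine (gf_horArcs_succ_le hx1 T).trans (mul_le_mul' ih ?_)
      calc 1 + 4 * gf (ENNReal.ofReal y) (bridges (T + 1))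
          ≤ 1 + 4 * ENNReal.ofReal (q ^ (T + 1)) := by gcongr; exact hB T
        _ = ENNReal.ofReal (1 + 4 * q ^ (T + 1)) := by
          rw [ENNReal.ofReal_add zero_le_one (by positivity), ENNReal.ofReal_mul (by norm_num)]
          simp
        _ ≤ _ := by
          refine ENNReal.ofReal_le_ofReal ?_
          rw [add_comm]
          exact Real.add_one_le_exp _
  refine ⟨ENNReal.ofReal (Real.exp (∑' i, 4 * q ^ (i + 1))), ENNReal.ofReal_ne_top, fun T => ?_⟩
  refine le_add_self.trans ((h1 T).trans (ENNReal.ofReal_le_ofReal (Real.exp_le_exp.2 ?_)))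
  exact hs.sum_le_tsum _ fun i _ => by positivity

/-- The walks from `o` through `n` vertices whose last step is horizontal. -/
def headWalks (o : ℤ × ℤ) (n : ℕ) : Set (List (ℤ × ℤ)) :=
  {l | IsSAW l ∧ l.getLast? = some o ∧ l.length = n ∧ HeadHorizontal l}

/-- The walks from `o` through `n` vertices whose first step is horizontal. -/
def tailWalks (o : ℤ × ℤ) (n : ℕ) : Set (List (ℤ × ℤ)) :=
  {l | IsSAW l ∧ l.getLast? = some o ∧ l.length = n ∧ HeadHorizontal l.reverse}

/-- The horizontal arcs, and the arc with one step. -/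
def arcPieces (T : ℕ) : Set (List (ℤ × ℤ)) := horArcs T ∪ {[(0, 1), (0, 0)]}

theorem map_add_mem_arcPieces {T : ℕ} {q : List (ℤ × ℤ)} {v c : ℤ × ℤ} (h : IsSAW (q ++ [v]))
    (hh : HeadHorizontal (q ++ [v])) (hv : ¬ Even (v.1 + v.2)) (hc : v + c = (0, 1))
    (hT : ∀ w ∈ q ++ [v], v.2 ≤ w.2 ∧ w.2 + 1 ≤ v.2 + T) :
    (q ++ [v]).map (· + c) ++ [(0, 0)] ∈ arcPieces T := by
  have hc1 : v.1 + c.1 = 0 := congrArg Prod.fst hc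
  have hc2 : v.2 + c.2 = 1 := congrArg Prod.snd hc
  have hce : Even (c.1 + c.2) := by
    rw [Int.even_iff] at *
    omega
  match q with
  | [] => exact .inr (by simp [hc])
  | a :: q =>
    refine .inl ⟨isArc_append (fun w hw => hw.1)
      (IsSAW.map (adj_add hce) (add_left_injective c) h)
      (by rw [List.getLast?_map, List.getLast?_append]; simp [hc]) ?_, ?_⟩
    · intro w hw
      obtain ⟨u, hu, rfl⟩ := List.mem_map.1 hw
      have := hT u hu
      simp only [strip, Prod.snd_add]
      omega
    · intro u t m e
      match hq : a :: q ++ [v], e with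
      | u' :: t' :: m', e =>
        simp only [List.map_cons, List.cons_append, List.cons.injEq] at e
        rw [← e.1, ← e.2.1, Prod.snd_add, Prod.snd_add, hh u' t' m' hq]
      | [u'], e => simp at hq

theorem gf_headWalks_inter_tailWalks_le {n : ℕ} (hn : 2 ≤ n) (o : ℤ × ℤ) (x : ℝ≥0∞) :
    x ^ 3 * gf x (headWalks o n ∩ tailWalks o n) ≤
      gf x (arcPieces (2 * n)) * gf x (arcPieces (2 * n)) := by
  refine gf_mul_le 3 (fun a b => a.dropLast.dropLast.map (· - (b.headD (0, 0) - o)) ++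
    (b.dropLast.map (· - (b.headD (0, 0) - o))).reverse) ?_
  rintro l ⟨⟨hs, ho, hlen, hh⟩, -, -, -, hr⟩
  have hrow : ∀ w ∈ l, |w.2 - o.2| ≤ n - 1 := by
    match l, hlen with
    | b :: l, hlen =>
      intro w hw
      have h1 := (abs_sub_getLast_le b l hs.1 w hw).2
      rw [List.getLast?_eq_some_getLast (List.cons_ne_nil _ _), Option.some.injEq] at ho
      rw [ho] at h1
      simp only [List.length_cons] at hlen
      rw [← hlen]
      push_cast
      linarith
    | [], hlen => simp at hlen; omega
  have hne : l.toFinset.Nonempty := by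
    rw [List.toFinset_nonempty_iff]
    rintro rfl
    simp at ho
  obtain ⟨v₀, hv₀, hmin₀⟩ := Finset.exists_min_image l.toFinset Prod.snd hne
  simp only [List.mem_toFinset] at hv₀ hmin₀
  obtain ⟨v, hv, hvo, hmin⟩ : ∃ v ∈ l, ¬ Even (v.1 + v.2) ∧ ∀ w ∈ l, v.2 ≤ w.2 := by
    by_cases he : Even (v₀.1 + v₀.2)
    · obtain ⟨v, hv, hadj, hv2⟩ := exists_horizontal hs (by omega) hv₀
        (fun t m e => hh v₀ t m e) fun t m e => hr v₀ t m.reverse (by simp [e])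
      refine ⟨v, hv, ?_, fun w hw => hv2 ▸ hmin₀ w hw⟩
      simp only [BrickAdj, Int.even_iff] at hadj he ⊢
      omega
    · exact ⟨v₀, hv₀, he, hmin₀⟩
  have hbound : ∀ w ∈ l, v.2 ≤ w.2 ∧ w.2 + 1 ≤ v.2 + (2 * n : ℕ) := by
    intro w hw
    have h1 := abs_le.1 (hrow w hw)
    have h2 := abs_le.1 (hrow v hv)
    refine ⟨hmin w hw, ?_⟩
    push_cast
    linarith [h1.2, h2.1]
  obtain ⟨A, B, rfl⟩ := List.append_of_mem hv
  set c : ℤ × ℤ := (0, 1) - v with hc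
  have hvc : v + c = (0, 1) := by simp [hc]
  have hrev : (v :: B).reverse = B.reverse ++ [v] := by simp
  have hhead : ((B.reverse ++ [v]).map (· + c) ++ [(0, 0)]).headD (0, 0) = o + c := by
    rw [List.getLast?_append_of_ne_nil _ (List.cons_ne_nil _ _), ← List.head?_reverse, hrev] at ho
    rw [List.headD_eq_head?_getD, List.head?_append, List.head?_map, ho]
    rfl
  refine ⟨(A ++ [v]).map (· + c) ++ [(0, 0)], map_add_mem_arcPieces hs.init ?_ hvo hvc ?_,
    (B.reverse ++ [v]).map (· + c) ++ [(0, 0)], map_add_mem_arcPieces ?_ ?_ hvo hvc ?_, ?_, ?_⟩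
  · rw [List.append_cons] at hh
    exact hh.left
  · exact fun w hw => hbound w (by simp at hw ⊢; tauto)
  · exact hrev ▸ hs.right.reverse
  · rw [List.reverse_append, hrev] at hr
    exact hr.left
  · exact fun w hw => hbound w (by simp at hw ⊢; tauto)
  · simp only [hhead]
    simp [Function.comp_def, hvc]
    simp [hc]
  · simp
    omega

theorem headHorizontal_or {l : List (ℤ × ℤ)} (h : IsSAW l) :
    HeadHorizontal l ∨ ∃ t m, l = vert t :: t :: m ∧ HeadHorizontal (t :: m) := by
  match l, h with
  | [], _ => exact .inl (by simp [HeadHorizontal])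
  | [a], _ => exact .inl (by simp [HeadHorizontal])
  | u :: t :: m, h =>
    have hut := adj_symm (List.isChain_cons_cons.1 h.1).1
    by_cases e : t.2 = u.2
    · left
      rintro u' t' m' e'
      simp only [List.cons.injEq] at e'
      rw [← e'.1, ← e'.2.1, e]
    · have hu := eq_vert_of_adj hut (Ne.symm e)
      refine .inr ⟨t, m, by rw [hu], ?_⟩
      rintro t' s m' e'
      simp only [List.cons.injEq] at e'
      obtain ⟨rfl, rfl⟩ := e'
      by_contra hs
      have hts := (List.isChain_cons_cons.1 (List.isChain_cons_cons.1 h.1).2).1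
      have := h.2
      rw [hu, eq_vert_of_adj hts hs] at this
      simp at this

theorem HeadHorizontal.right {l m : List (ℤ × ℤ)} (h : HeadHorizontal l.reverse) (hm : m <:+ l) :
    HeadHorizontal m.reverse := by
  obtain ⟨k, rfl⟩ := hm
  rw [List.reverse_append] at h
  exact h.left

theorem tailWalks_succ_subset (o : ℤ × ℤ) (n : ℕ) : tailWalks o (n + 1) ⊆
    (headWalks o (n + 1) ∩ tailWalks o (n + 1)) ∪
      Set.image2 (fun (_ : List (ℤ × ℤ)) l => vert (l.headD 0) :: l) {[(0, 0)]}
        (headWalks o n ∩ tailWalks o n) := by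
  intro l hl
  rcases headHorizontal_or hl.1 with h | ⟨t, m, rfl, h⟩
  · exact .inl ⟨⟨hl.1, hl.2.1, hl.2.2.1, h⟩, hl⟩
  · obtain ⟨hs, ho, hlen, hr⟩ := hl
    have hs' : IsSAW (t :: m) := IsSAW.right (l := [vert t]) hs
    have hlen' : (t :: m).length = n := by simpa using hlen
    have ho' : (t :: m).getLast? = some o := by simpa [List.getLast?_cons_cons] using ho
    exact .inr ⟨_, rfl, t :: m, ⟨⟨hs', ho', hlen', h⟩, hs', ho', hlen',
      hr.right (List.suffix_cons _ _)⟩, rfl⟩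

theorem walksOf_subset (n : ℕ) : walksOf n ⊆ tailWalks (0, 0) (n + 1) ∪
    Set.image2 (fun l b => l ++ b) (tailWalks (0, 1) n) {[(0, 0)]} := by
  rintro l ⟨⟨hs, ho⟩, hlen⟩
  rcases headHorizontal_or hs.reverse with h | ⟨t, m, e, h⟩
  · exact .inl ⟨hs, ho, hlen, h⟩
  · have hl : l = (t :: m).reverse ++ [vert t] := by
      rw [← l.reverse_reverse, e]
      simp
    have hvt : vert t = (0, 0) := by simpa [hl] using ho
    have ht : t = (0, 1) := by
      simp only [vert, Int.even_iff] at hvt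
      split_ifs at hvt <;> simp only [Prod.ext_iff] at hvt ⊢ <;> omega
    subst ht
    rw [hvt] at hl
    subst hl
    refine .inr ⟨_, ⟨hs.left, by simp, by simpa using hlen, by simpa using h⟩, _, rfl, rfl⟩

theorem exists_brickSawCount_mul_pow_le {y : ℝ} (hy0 : 0 < y) (hy : y < xc) :
    ∃ K : ℝ, 0 < K ∧ ∀ n, 3 ≤ n → brickSawCount n * y ^ n ≤ K := by
  obtain ⟨K, hK, hle⟩ := exists_gf_horArcs_le hy0.le hy
  set x := ENNReal.ofReal y with hx
  have hx0 : x ≠ 0 := by simpa [hx] using hy0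
  have hxt : x ≠ ∞ := ENNReal.ofReal_ne_top
  have hx1 : x ≤ 1 := ENNReal.ofReal_le_one.2 (hy.le.trans xc_le_one)
  have hP : ∀ T, gf x (arcPieces T) ≤ K + 1 := fun T =>
    gf_union_le.trans (add_le_add (hle T) (by rw [gf_singleton]; exact pow_le_one' hx1 _))
  set C := (K + 1) * (K + 1) / x ^ 3 with hC
  have hx3 : x ^ 3 ≠ 0 := pow_ne_zero _ hx0
  have hCt : C ≠ ∞ := ENNReal.div_ne_top (by finiteness) hx3
  have h1 : ∀ o n, 2 ≤ n → gf x (headWalks o n ∩ tailWalks o n) ≤ C := by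
    intro o n hn
    rw [hC, ENNReal.le_div_iff_mul_le (.inl hx3) (.inl (by finiteness)), mul_comm]
    exact (gf_headWalks_inter_tailWalks_le hn o x).trans (mul_le_mul' (hP _) (hP _))
  have hpt : gf x {[(0, 0)]} ≤ 1 := by
    rw [gf_singleton]
    exact pow_le_one' hx1 _
  have h2 : ∀ o n, 3 ≤ n → gf x (tailWalks o n) ≤ C + C := by
    intro o n hn
    obtain ⟨n, rfl⟩ := Nat.exists_eq_add_of_le' (show 1 ≤ n by omega)
    refine (gf_mono (tailWalks_succ_subset o n)).trans (gf_union_le.trans ?_)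
    refine add_le_add (h1 o _ (by omega)) ?_
    refine (gf_image2_le (fun _ l => vert (l.headD 0) :: l) fun a ha b _ => ?_).trans
      ((mul_le_mul' hpt (h1 o n (by omega))).trans_eq (one_mul _))
    rw [Set.mem_singleton_iff.1 ha]
    simp [add_comm]
  have h3 : ∀ n, 3 ≤ n → gf x (walksOf n) ≤ (C + C) + (C + C) := by
    intro n hn
    refine (gf_mono (walksOf_subset n)).trans (gf_union_le.trans ?_)
    refine add_le_add (h2 _ _ (by omega)) ?_
    exact (gf_image2_le _ fun a _ b _ => List.length_append).trans
      ((mul_le_mul' (h2 _ _ hn) hpt).trans_eq (mul_one _))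
  have hDt : (C + C) + (C + C) ≠ ∞ := by finiteness
  refine ⟨((C + C) + (C + C)).toReal / y + 1, by positivity, fun n hn => ?_⟩
  have h4 := ENNReal.toReal_mono hDt (h3 n hn)
  rw [gf_walksOf, ENNReal.toReal_mul, ENNReal.toReal_pow, hx, ENNReal.toReal_ofReal hy0.le,
    ENNReal.toReal_natCast, pow_succ, ← mul_assoc, ← le_div_iff₀ hy0] at h4
  linarith

end BrickLattice

open BrickLattice

/-- **Duminil-Copin–Smirnov.** The connective constant of the hexagonal lattice equals
`√(2 + √2)`: for the brick lattice `H`, `lim_{n→∞} σ_n(H)^{1/n} = √(2 + √2)`. -/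
theorem duminil_copin_smirnov :
    Tendsto (fun n : ℕ => (brickSawCount n : ℝ) ^ (1 / (n : ℝ))) atTop
      (𝓝 (Real.sqrt (2 + Real.sqrt 2))) := by
  rw [← xc_inv]
  have hx := xc_pos
  refine tendsto_order.2 ⟨fun a ha => ?_, fun b hb => ?_⟩
  · filter_upwards [eventually_ge_atTop 1] with n hn
    refine ha.trans_le ?_
    have hn' : n ≠ 0 := by omega
    rw [one_div, ← Real.pow_rpow_inv_natCast (inv_nonneg.2 hx.le) hn']
    refine Real.rpow_le_rpow (by positivity) ?_ (by positivity)
    rw [inv_pow, inv_le_iff_one_le_mul₀ (by positivity)]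
    exact one_le_brickSawCount_mul_pow n
  · have hb0 : 0 < b := (inv_pos.2 hx).trans hb
    obtain ⟨y, hy1, hy2⟩ := exists_between (inv_lt_of_inv_lt₀ hx hb)
    have hy0 : 0 < y := (inv_pos.2 hb0).trans hy1
    obtain ⟨K, hK0, hK⟩ := exists_brickSawCount_mul_pow_le hy0 hy2
    have hlim : Tendsto (fun n : ℕ => K ^ (1 / (n : ℝ)) * y⁻¹) atTop (𝓝 y⁻¹) := by
      have := (tendsto_const_nhds (x := K)).rpow (tendsto_one_div_atTop_nhds_zero_nat (𝕜 := ℝ))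
        (.inl hK0.ne')
      simpa using this.mul_const y⁻¹
    filter_upwards [hlim.eventually_lt_const (inv_lt_of_inv_lt₀ hb0 hy1), eventually_ge_atTop 3]
      with n h1 hn
    refine lt_of_le_of_lt ?_ h1
    have hn' : n ≠ 0 := by omega
    rw [one_div, ← Real.pow_rpow_inv_natCast (inv_nonneg.2 hy0.le) hn',
      ← Real.mul_rpow hK0.le (by positivity)]
    refine Real.rpow_le_rpow (by positivity) ?_ (by positivity)
    rw [inv_pow, ← div_eq_mul_inv, le_div_iff₀ (by positivity)]
    exact hK n hn
end

section
/- (Subadditive ergodic theorem, Kingman's form of the Hammersley–Welsh theorem) Let (Ω, F, μ) be a probability space, let T : Ω → Ω be measure-preserving, and let (X_n)_{n≥1} be a sequence of integrable real-valued random variables satisfying X_{m+n} ≤ X_m + X_n ∘ T^m almost everywhere for all m, n ≥ 1, and inf_{n≥1} E[X_n]/n > −∞. Then X_n/n converges almost everywhere and in L¹ to an integrable, T-invariant random variable X, and E[X] = lim_{n→∞} E[X_n]/n = inf_{n≥1} E[X_n]/n. -/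
open Filter Topology MeasureTheory

section

variable {Ω : Type*} [MeasurableSpace Ω] {μ : Measure Ω} {T : Ω → Ω}

namespace MeasureTheory.MeasurePreserving

theorem ae_iterate (hT : MeasurePreserving T μ μ) {p : Ω → Prop} (hp : ∀ᵐ ω ∂μ, p ω) :
    ∀ᵐ ω ∂μ, ∀ i : ℕ, p (T^[i] ω) :=
  ae_all_iff.2 fun i => (hT.iterate i).quasiMeasurePreserving.ae hp

theorem integral_comp_of_integrable (hT : MeasurePreserving T μ μ) {g : Ω → ℝ}
    (hg : Integrable g μ) : ∫ ω, g (T ω) ∂μ = ∫ ω, g ω ∂μ := by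
  have h : AEStronglyMeasurable g (μ.map T) := by
    rw [hT.map_eq]; exact hg.aestronglyMeasurable
  rw [← integral_map hT.measurable.aemeasurable h, hT.map_eq]

theorem ae_eq_comp_of_ae_le_comp (hT : MeasurePreserving T μ μ) {g : Ω → ℝ}
    (hg : Integrable g μ) (hle : ∀ᵐ ω ∂μ, g ω ≤ g (T ω)) : ∀ᵐ ω ∂μ, g (T ω) = g ω := by
  have h := (integral_eq_iff_of_ae_le hg (hT.integrable_comp_of_integrable hg) hle).1
    (hT.integral_comp_of_integrable hg).symm
  filter_upwards [h] with ω hω using hω.symm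

theorem integrable_birkhoffSum (hT : MeasurePreserving T μ μ) {g : Ω → ℝ}
    (hg : Integrable g μ) (n : ℕ) : Integrable (fun ω => birkhoffSum T g n ω) μ :=
  integrable_finsetSum _ fun i _ => (hT.iterate i).integrable_comp_of_integrable hg

theorem integral_birkhoffSum (hT : MeasurePreserving T μ μ) {g : Ω → ℝ}
    (hg : Integrable g μ) (n : ℕ) : ∫ ω, birkhoffSum T g n ω ∂μ = n * ∫ ω, g ω ∂μ := by
  simp only [birkhoffSum]
  have hi : ∀ i ∈ Finset.range n, Integrable (fun ω => g (T^[i] ω)) μ := fun i _ =>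
    (hT.iterate i).integrable_comp_of_integrable hg
  rw [integral_finsetSum _ hi]
  simp [(hT.iterate _).integral_comp_of_integrable hg]

end MeasureTheory.MeasurePreserving

theorem measurable_birkhoffSum (hT : Measurable T) {g : Ω → ℝ} (hg : Measurable g) (n : ℕ) :
    Measurable fun ω => birkhoffSum T g n ω :=
  Finset.measurable_sum _ fun i _ => hg.comp (hT.iterate i)

theorem le_birkhoffSum_add {Ω : Type*} {T : Ω → Ω} {X : ℕ → Ω → ℝ} {g : Ω → ℝ} {k : ℕ} {K : ℝ}
    {G : Set Ω} (hG : ∀ ω ∈ G, T ω ∈ G)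
    (hsub : ∀ ω ∈ G, ∀ m n : ℕ, 1 ≤ m → 1 ≤ n → X (m + n) ω ≤ X m ω + X n (T^[m] ω))
    (hsmall : ∀ ω ∈ G, ∀ n, 1 ≤ n → n ≤ k → X n ω ≤ birkhoffSum T g n ω + K)
    (hstep : ∀ ω ∈ G, ∃ j, 1 ≤ j ∧ j ≤ k ∧ X j ω ≤ birkhoffSum T g j ω) (n : ℕ) (hn : 1 ≤ n) :
    ∀ ω ∈ G, X n ω ≤ birkhoffSum T g n ω + K := by
  have hG' : ∀ j : ℕ, ∀ ω ∈ G, T^[j] ω ∈ G := fun j => Set.MapsTo.iterate hG j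
  induction n using Nat.strong_induction_on with
  | _ n ih =>
    intro ω hω
    by_cases hnk : n ≤ k
    · exact hsmall ω hω n hn hnk
    · obtain ⟨j, hj1, hjk, hj⟩ := hstep ω hω
      have h1 := hsub ω hω j (n - j) hj1 (by omega)
      have h2 := ih (n - j) (by omega) (by omega) _ (hG' j ω hω)
      have h3 := birkhoffSum_add T g j (n - j) ω
      rw [show j + (n - j) = n by omega] at h1 h3
      linarith

/-- `X` is subadditive over `T`: `X (m + n) ≤ X m + X n ∘ T^m` almost everywhere for `m, n ≥ 1`. -/
def IsSubadditiveOver (μ : Measure Ω) (T : Ω → Ω) (X : ℕ → Ω → ℝ) : Prop :=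
  ∀ m n : ℕ, 1 ≤ m → 1 ≤ n → ∀ᵐ ω ∂μ, X (m + n) ω ≤ X m ω + X n (T^[m] ω)

theorem abs_div_natCast_le {x C : ℝ} {n : ℕ} (hC : 0 ≤ C) (h : |x| ≤ C * n) : |x / n| ≤ C := by
  rw [abs_div, Nat.abs_cast]
  exact div_le_of_le_mul₀ n.cast_nonneg hC h

theorem isBoundedUnder_le_of_abs_le {u : ℕ → ℝ} {C : ℝ} (h : ∀ n, |u n| ≤ C) :
    IsBoundedUnder (· ≤ ·) atTop u :=
  isBoundedUnder_of ⟨C, fun n => (abs_le.1 (h n)).2⟩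

theorem isBoundedUnder_ge_of_abs_le {u : ℕ → ℝ} {C : ℝ} (h : ∀ n, |u n| ≤ C) :
    IsBoundedUnder (· ≥ ·) atTop u :=
  isBoundedUnder_of ⟨-C, fun n => (abs_le.1 (h n)).1⟩

theorem abs_liminf_le {u : ℕ → ℝ} {C : ℝ} (h : ∀ n, |u n| ≤ C) : |liminf u atTop| ≤ C := by
  have h1 := isBoundedUnder_le_of_abs_le h
  have h2 := isBoundedUnder_ge_of_abs_le h
  refine abs_le.2 ⟨le_liminf_of_le h1.isCoboundedUnder_ge
    (.of_forall fun n => (abs_le.1 (h n)).1), ?_⟩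
  exact (liminf_le_limsup h1 h2).trans (limsup_le_of_le h2.isCoboundedUnder_le
    (.of_forall fun n => (abs_le.1 (h n)).2))

theorem abs_limsup_le {u : ℕ → ℝ} {C : ℝ} (h : ∀ n, |u n| ≤ C) : |limsup u atTop| ≤ C := by
  have h1 := isBoundedUnder_le_of_abs_le h
  have h2 := isBoundedUnder_ge_of_abs_le h
  refine abs_le.2 ⟨(le_liminf_of_le h1.isCoboundedUnder_ge
    (.of_forall fun n => (abs_le.1 (h n)).1)).trans (liminf_le_limsup h1 h2), ?_⟩
  exact limsup_le_of_le h2.isCoboundedUnder_le (.of_forall fun n => (abs_le.1 (h n)).2)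

theorem liminf_div_le_liminf_div {u v : ℕ → ℝ} {C a : ℝ} (hC : 0 ≤ C) (hu : ∀ n, |u n| ≤ C * n)
    (hv : ∀ n, |v n| ≤ C * n) (h : ∀ n, 1 ≤ n → u (n + 1) ≤ a + v n) :
    liminf (fun n => u n / n) atTop ≤ liminf (fun n => v n / n) atTop := by
  have hu' := fun n => abs_div_natCast_le hC (hu n)
  have hv' := fun n => abs_div_natCast_le hC (hv n)
  refine le_of_forall_lt fun b hb => ?_
  obtain ⟨c, hbc, hc⟩ := exists_between hb
  refine hbc.trans_le ?_
  have hlim : Tendsto (fun n : ℕ => c + (c - a) / n) atTop (𝓝 c) := by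
    simpa using tendsto_const_nhds.add (tendsto_const_div_atTop_nhds_zero_nat (c - a))
  rw [← hlim.liminf_eq]
  refine liminf_le_liminf ?_ hlim.isBoundedUnder_ge
    (isBoundedUnder_le_of_abs_le hv').isCoboundedUnder_ge
  have he := (tendsto_add_atTop_nat 1).eventually
    (eventually_lt_of_lt_liminf hc (isBoundedUnder_ge_of_abs_le hu'))
  filter_upwards [he, eventually_ge_atTop 1] with n hn h1
  have hpos : (0 : ℝ) < n := by exact_mod_cast h1
  rw [lt_div_iff₀ (by positivity)] at hn
  rw [le_div_iff₀ hpos, add_mul, div_mul_cancel₀ _ hpos.ne']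
  have := h n h1
  push_cast at hn
  linarith

theorem le_integral_liminf_of_bounded [IsProbabilityMeasure μ] (hT : MeasurePreserving T μ μ)
    {X : ℕ → Ω → ℝ} (hX : ∀ n, Measurable (X n)) {C : ℝ} (hC : 0 ≤ C)
    (hXC : ∀ n ω, |X n ω| ≤ C * n) (hsub : IsSubadditiveOver μ T X) {c : ℝ}
    (hc : ∀ n : ℕ, 1 ≤ n → c ≤ (∫ ω, X n ω ∂μ) / n) :
    c ≤ ∫ ω, liminf (fun n : ℕ => X n ω / n) atTop ∂μ := by
  have hdiv : ∀ ω n, |X n ω / n| ≤ C := fun ω n => abs_div_natCast_le hC (hXC n ω)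
  set φ : Ω → ℝ := fun ω => liminf (fun n : ℕ => X n ω / n) atTop with hφ
  have hφm : Measurable φ := Measurable.liminf fun n => (hX n).div_const _
  have hφC : ∀ ω, |φ ω| ≤ C := fun ω => abs_liminf_le (hdiv ω)
  have hφi : Integrable φ μ := .of_bound hφm.aestronglyMeasurable C (.of_forall hφC)
  have hinv : ∀ᵐ ω ∂μ, φ (T ω) = φ ω := by
    refine hT.ae_eq_comp_of_ae_le_comp hφi ?_
    have h1 : ∀ᵐ ω ∂μ, ∀ n, 1 ≤ n → X (1 + n) ω ≤ X 1 ω + X n (T ω) :=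
      ae_all_iff.2 fun n => eventually_imp_distrib_left.2 fun hn => hsub 1 n le_rfl hn
    filter_upwards [h1] with ω hω
    exact liminf_div_le_liminf_div hC (fun n => hXC n ω) (fun n => hXC n (T ω))
      fun n hn => by rw [add_comm]; exact hω n hn
  refine le_of_forall_pos_le_add fun ε hε => ?_
  let E : ℕ → Set Ω := fun k => ⋃ j ∈ Finset.Icc 1 k, {ω | X j ω ≤ j * (φ ω + ε)}
  have hEm : ∀ k, MeasurableSet (E k) := fun k =>
    Finset.measurableSet_biUnion _ fun j _ =>
      measurableSet_le (hX j) ((hφm.add_const ε).const_mul _)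
  let g : ℕ → Ω → ℝ := fun k ω => φ ω + ε + (E k)ᶜ.indicator (fun _ => 2 * C) ω
  have hind : ∀ k ω, 0 ≤ (E k)ᶜ.indicator (fun _ => 2 * C) ω ∧
      (E k)ᶜ.indicator (fun _ => 2 * C) ω ≤ 2 * C := fun k ω =>
    ⟨Set.indicator_nonneg (fun _ _ => by positivity) _,
      Set.indicator_le_self' (fun _ _ => by positivity) _⟩
  have hgm : ∀ k, Measurable (g k) := fun k =>
    (hφm.add_const ε).add (measurable_const.indicator (hEm k).compl)
  have hgC : ∀ k ω, |g k ω| ≤ 3 * C + ε := fun k ω => by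
    have := abs_le.1 (hφC ω)
    have := hind k ω
    simp only [g]
    rw [abs_le]; constructor <;> linarith
  have hgi : ∀ k, Integrable (g k) μ := fun k =>
    .of_bound (hgm k).aestronglyMeasurable _ (.of_forall (hgC k))
  have hglim : Tendsto (fun k => ∫ ω, g k ω ∂μ) atTop (𝓝 (∫ ω, (φ ω + ε) ∂μ)) := by
    refine tendsto_integral_of_dominated_convergence (fun _ => 3 * C + ε)
      (fun k => (hgm k).aestronglyMeasurable) (integrable_const _)
      (fun k => .of_forall (hgC k)) (.of_forall fun ω => ?_)
    have hfr : ∃ᶠ n in atTop, X n ω / n < φ ω + ε :=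
      frequently_lt_of_liminf_lt (isBoundedUnder_le_of_abs_le (hdiv ω)).isCoboundedUnder_ge
        (by simpa [hφ] using hε)
    obtain ⟨j, hj, hj1⟩ := (hfr.and_eventually (eventually_ge_atTop 1)).exists
    refine tendsto_const_nhds.congr' ?_
    filter_upwards [eventually_ge_atTop j] with k hk
    have : ω ∈ E k := by
      simp only [E, Set.mem_iUnion]
      refine ⟨j, Finset.mem_Icc.2 ⟨hj1, hk⟩, ?_⟩
      have hpos : (0 : ℝ) < j := by exact_mod_cast hj1
      rw [div_lt_iff₀ hpos] at hj
      simp only [Set.mem_ofPred_eq]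
      linarith
    simp [g, this]
  have hmain : ∀ k, 1 ≤ k → c ≤ ∫ ω, g k ω ∂μ := by
    intro k hk
    let G : Set Ω := {ω | ∀ i : ℕ, φ (T (T^[i] ω)) = φ (T^[i] ω) ∧
      ∀ m n : ℕ, 1 ≤ m → 1 ≤ n → X (m + n) (T^[i] ω) ≤ X m (T^[i] ω) + X n (T^[m] (T^[i] ω))}
    have hGae : ∀ᵐ ω ∂μ, ω ∈ G := by
      refine hT.ae_iterate (p := fun ω => φ (T ω) = φ ω ∧
        ∀ m n : ℕ, 1 ≤ m → 1 ≤ n → X (m + n) ω ≤ X m ω + X n (T^[m] ω)) (hinv.and ?_)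
      simp only [ae_all_iff, eventually_imp_distrib_left]
      exact hsub
    have hGT : ∀ ω ∈ G, T ω ∈ G := fun ω hω i => by
      simpa only [Function.iterate_succ_apply] using hω (i + 1)
    have hGφ : ∀ ω ∈ G, ∀ i, φ (T^[i] ω) = φ ω := fun ω hω i => by
      induction i with
      | zero => rfl
      | succ i ih => rw [Function.iterate_succ_apply', (hω i).1, ih]
    have hlow : ∀ ω ∈ G, ∀ n : ℕ, n * (φ ω + ε) ≤ birkhoffSum T (g k) n ω := by
      intro ω hω n
      have := Finset.card_nsmul_le_sum (Finset.range n) (fun i => g k (T^[i] ω)) (φ ω + ε)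
        fun i _ => by
          have := (hind k (T^[i] ω)).1
          simp only [g, hGφ ω hω i]
          linarith
      simpa only [Finset.card_range, nsmul_eq_mul, birkhoffSum] using this
    have hpt := le_birkhoffSum_add (X := X) (g := g k) (k := k) (K := 2 * C * k) hGT
      (fun ω hω => (hω 0).2)
      (fun ω hω n hn hnk => by
        have h1 := hlow ω hω n
        have h2 := (abs_le.1 (hXC n ω)).2
        have h3 := (abs_le.1 (hφC ω)).1
        have h4 : (n : ℝ) ≤ k := by exact_mod_cast hnk
        have h5 : (n : ℝ) * (-C) ≤ n * (φ ω + ε) := by gcongr; linarith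
        nlinarith)
      (fun ω hω => by
        by_cases hE : ω ∈ E k
        · simp only [E, Set.mem_iUnion] at hE
          obtain ⟨j, hj, hjX⟩ := hE
          rw [Finset.mem_Icc] at hj
          exact ⟨j, hj.1, hj.2, le_trans hjX (hlow ω hω j)⟩
        · refine ⟨1, le_rfl, hk, ?_⟩
          have h2 := (abs_le.1 (hXC 1 ω)).2
          have h3 := (abs_le.1 (hφC ω)).1
          rw [birkhoffSum_one]
          simp only [g, Set.indicator_of_mem (show ω ∈ (E k)ᶜ from hE)]
          simp at h2
          linarith)
    have hbound : ∀ n : ℕ, 1 ≤ n → c ≤ ∫ ω, g k ω ∂μ + 2 * C * k / n := by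
      intro n hn
      have hpos : (0 : ℝ) < n := by exact_mod_cast hn
      have hXi : Integrable (X n) μ :=
        .of_bound (hX n).aestronglyMeasurable (C * n) (.of_forall (hXC n))
      have h1 := integral_mono_ae hXi ((hT.integrable_birkhoffSum (hgi k) n).add
        (integrable_const (2 * C * k))) (hGae.mono (hpt n hn))
      simp only [Pi.add_apply] at h1
      rw [integral_add (hT.integrable_birkhoffSum (hgi k) n) (integrable_const _),
        hT.integral_birkhoffSum (hgi k)] at h1
      refine (hc n hn).trans ?_
      rw [div_le_iff₀ hpos, add_mul, div_mul_cancel₀ _ hpos.ne']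
      simp at h1
      linarith
    have hlim : Tendsto (fun n : ℕ => ∫ ω, g k ω ∂μ + 2 * C * k / n) atTop
        (𝓝 (∫ ω, g k ω ∂μ)) := by
      simpa using tendsto_const_nhds.add (tendsto_const_div_atTop_nhds_zero_nat (2 * C * k))
    exact ge_of_tendsto hlim ((eventually_ge_atTop 1).mono hbound)
  have := ge_of_tendsto hglim ((eventually_ge_atTop 1).mono hmain)
  rw [integral_add hφi (integrable_const ε)] at this
  simpa using this

theorem IsSubadditiveOver.integral_add_le (hT : MeasurePreserving T μ μ) {X : ℕ → Ω → ℝ}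
    (hX : ∀ n, 1 ≤ n → Integrable (X n) μ) (hsub : IsSubadditiveOver μ T X) (m n : ℕ)
    (hm : 1 ≤ m) (hn : 1 ≤ n) :
    ∫ ω, X (m + n) ω ∂μ ≤ ∫ ω, X m ω ∂μ + ∫ ω, X n ω ∂μ := by
  have hi : Integrable (fun ω => X n (T^[m] ω)) μ :=
    (hT.iterate m).integrable_comp_of_integrable (hX n hn)
  have h := integral_mono_ae (hX (m + n) (by omega)) ((hX m hm).add hi) (hsub m n hm hn)
  simp only [Pi.add_apply] at h
  rwa [integral_add (hX m hm) hi, (hT.iterate m).integral_comp_of_integrable (hX n hn)] at h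

theorem exists_tendsto_div_of_subadditive {u : ℕ → ℝ}
    (hu : ∀ m n : ℕ, 1 ≤ m → 1 ≤ n → u (m + n) ≤ u m + u n) {c : ℝ}
    (hc : ∀ n : ℕ, 1 ≤ n → c ≤ u n / n) :
    ∃ L, Tendsto (fun n : ℕ => u n / n) atTop (𝓝 L) ∧ ∀ n : ℕ, 1 ≤ n → L ≤ u n / n := by
  let v : ℕ → ℝ := fun n => if n = 0 then 0 else u n
  have hvu : ∀ n, 1 ≤ n → v n = u n := fun n hn => if_neg (by omega)
  have hv : Subadditive v := by
    intro m n
    rcases Nat.eq_zero_or_pos m with rfl | hm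
    · simp [v]
    rcases Nat.eq_zero_or_pos n with rfl | hn
    · simp [v]
    rw [hvu _ hm, hvu _ hn, hvu _ (by omega)]
    exact hu m n hm hn
  have hbdd : BddBelow (Set.range fun n => v n / n) := by
    refine ⟨min c 0, ?_⟩
    rintro _ ⟨n, rfl⟩
    rcases Nat.eq_zero_or_pos n with rfl | hn
    · simp
    · simp only [hvu n hn]
      exact (min_le_left _ _).trans (hc n hn)
  refine ⟨hv.lim, (hv.tendsto_lim hbdd).congr' ?_, fun n hn => ?_⟩
  · filter_upwards [eventually_ge_atTop 1] with n hn
    rw [hvu n hn]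
  · rw [← hvu n hn]
    exact hv.lim_le_div hbdd (by omega)

theorem abs_birkhoffSum_le {Ω : Type*} {T : Ω → Ω} {g : Ω → ℝ} {C : ℝ} (hg : ∀ ω, |g ω| ≤ C)
    (n : ℕ) (ω : Ω) : |birkhoffSum T g n ω| ≤ C * n := by
  refine (Finset.abs_sum_le_sum_abs _ _).trans ?_
  refine (Finset.sum_le_card_nsmul _ _ C fun i _ => hg _).trans ?_
  simp [mul_comm]

theorem mul_limsup_div_le_neg_liminf_div {u w : ℕ → ℝ} {k : ℕ} {C : ℝ} (hk : 1 ≤ k)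
    (hu : ∀ n, |u n / n| ≤ C) (hw : ∀ n, |w n / n| ≤ C) (h : ∀ n, u n ≤ -w (n / k)) :
    k * limsup (fun n => u n / n) atTop ≤ -liminf (fun n => w n / n) atTop := by
  have hkpos : (0 : ℝ) < k := by exact_mod_cast hk
  rw [le_neg]
  refine le_of_forall_lt fun b hb => ?_
  obtain ⟨c, hbc, hc⟩ := exists_between hb
  refine hbc.trans_le ?_
  rw [le_neg, mul_comm, ← le_div_iff₀ hkpos]
  have hlim : Tendsto (fun n : ℕ => -c / k + |c| / n) atTop (𝓝 (-c / k)) := by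
    simpa using tendsto_const_nhds.add (tendsto_const_div_atTop_nhds_zero_nat |c|)
  rw [← hlim.limsup_eq]
  refine limsup_le_limsup ?_ (isBoundedUnder_ge_of_abs_le hu).isCoboundedUnder_le
    hlim.isBoundedUnder_le
  have he := (Nat.tendsto_div_const_atTop (n := k) (by omega)).eventually
    ((eventually_lt_of_lt_liminf hc (isBoundedUnder_ge_of_abs_le hw)).and (eventually_ge_atTop 1))
  filter_upwards [he, eventually_ge_atTop 1] with n hn h1
  obtain ⟨hn, hnk⟩ := hn
  have hpos : (0 : ℝ) < n := by exact_mod_cast h1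
  have hpos' : (0 : ℝ) < (n / k : ℕ) := by exact_mod_cast hnk
  rw [lt_div_iff₀ hpos'] at hn
  rw [div_le_iff₀ hpos, add_mul, div_mul_cancel₀ _ hpos.ne']
  have h2 : ((n / k : ℕ) : ℝ) ≤ n / k := Nat.cast_div_le
  have h3 : (n : ℝ) / k ≤ (n / k : ℕ) + 1 := by
    rw [← Nat.floor_div_eq_div (K := ℝ)]
    exact (Nat.lt_floor_add_one _).le
  have h4 := h n
  have h5 : -c / k * n = -c * (n / k) := by ring
  rw [h5]
  rcases abs_cases c with ⟨hc1, hc2⟩ | ⟨hc1, hc2⟩ <;> rw [hc1] <;> nlinarith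

theorem integral_limsup_le_of_bounded [IsProbabilityMeasure μ] (hT : MeasurePreserving T μ μ)
    {X : ℕ → Ω → ℝ} (hX : ∀ n, Measurable (X n)) {C : ℝ} (hC : 0 ≤ C)
    (hXC : ∀ n ω, |X n ω| ≤ C * n) (hneg : ∀ n ω, X n ω ≤ 0) (hsub : IsSubadditiveOver μ T X)
    {k : ℕ} (hk : 1 ≤ k) :
    ∫ ω, limsup (fun n : ℕ => X n ω / n) atTop ∂μ ≤ (∫ ω, X k ω ∂μ) / k := by
  have hkpos : (0 : ℝ) < k := by exact_mod_cast hk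
  have hTk := hT.iterate k
  have hXki : Integrable (X k) μ :=
    .of_bound (hX k).aestronglyMeasurable (C * k) (.of_forall (hXC k))
  let W : ℕ → Ω → ℝ := fun n ω => -birkhoffSum T^[k] (X k) n ω
  have hWm : ∀ n, Measurable (W n) := fun n => (measurable_birkhoffSum hTk.measurable (hX k) n).neg
  have hWC : ∀ n ω, |W n ω| ≤ C * k * n := fun n ω => by
    simpa only [W, abs_neg] using abs_birkhoffSum_le (hXC k) n ω
  have hWsub : IsSubadditiveOver μ T^[k] W := fun m n _ _ => .of_forall fun ω => by
    simp only [W, birkhoffSum_add]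
    linarith
  have hWint : ∀ n : ℕ, 1 ≤ n → -∫ ω, X k ω ∂μ ≤ (∫ ω, W n ω ∂μ) / n := fun n hn => by
    have hpos : (0 : ℝ) < n := by exact_mod_cast hn
    simp only [W]
    rw [integral_neg, hTk.integral_birkhoffSum hXki, neg_div, mul_div_cancel_left₀ _ hpos.ne']
  have key := le_integral_liminf_of_bounded hTk hWm (by positivity) hWC hWsub hWint
  have hdivX : ∀ ω n, |X n ω / n| ≤ C := fun ω n => abs_div_natCast_le hC (hXC n ω)
  have hdivW : ∀ ω n, |W n ω / n| ≤ C * k := fun ω n =>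
    abs_div_natCast_le (by positivity) (hWC n ω)
  have hpt : ∀ᵐ ω ∂μ, k * limsup (fun n : ℕ => X n ω / n) atTop ≤
      -liminf (fun n : ℕ => W n ω / n) atTop := by
    have hae : ∀ᵐ ω ∂μ, ∀ n, 1 ≤ n → X (k + n) ω ≤ X k ω + X n (T^[k] ω) :=
      ae_all_iff.2 fun n => eventually_imp_distrib_left.2 fun hn => hsub k n hk hn
    filter_upwards [hTk.ae_iterate hae] with ω hω
    refine mul_limsup_div_le_neg_liminf_div (C := C * k) hk
      (fun n => (hdivX ω n).trans (le_mul_of_one_le_right hC (by exact_mod_cast hk))) (hdivW ω)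
      fun n => ?_
    simp only [W, neg_neg]
    induction n using Nat.strong_induction_on generalizing ω with
    | _ n ih =>
      rcases lt_trichotomy n k with hnk | rfl | hnk
      · rw [Nat.div_eq_of_lt hnk, birkhoffSum_zero]
        exact hneg n ω
      · rw [Nat.div_self (by omega), birkhoffSum_one]
      · have h1 := hω 0 (n - k) (by omega)
        have h2 := ih (n - k) (by omega) (T^[k] ω) fun i => by
          simpa only [Function.iterate_succ_apply] using hω (i + 1)
        rw [Nat.div_eq_sub_div (by omega) hnk.le, birkhoffSum_succ']
        simp only [Function.iterate_zero, id, Nat.add_sub_cancel' hnk.le] at h1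
        linarith
  have hsup : Integrable (fun ω => limsup (fun n : ℕ => X n ω / n) atTop) μ :=
    .of_bound (Measurable.limsup fun n => (hX n).div_const _).aestronglyMeasurable C
      (.of_forall fun ω => abs_limsup_le (hdivX ω))
  have hinf : Integrable (fun ω => liminf (fun n : ℕ => W n ω / n) atTop) μ :=
    .of_bound (Measurable.liminf fun n => (hWm n).div_const _).aestronglyMeasurable (C * k)
      (.of_forall fun ω => abs_liminf_le (hdivW ω))
  have h := integral_mono_ae (hsup.const_mul (k : ℝ)) hinf.neg hpt
  simp only [Pi.neg_apply] at h
  rw [integral_const_mul, integral_neg] at h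
  rw [le_div_iff₀ hkpos]
  linarith

theorem ae_tendsto_limsup_of_bounded [IsProbabilityMeasure μ] (hT : MeasurePreserving T μ μ)
    {X : ℕ → Ω → ℝ} (hX : ∀ n, Measurable (X n)) {C : ℝ} (hC : 0 ≤ C)
    (hXC : ∀ n ω, |X n ω| ≤ C * n) (hneg : ∀ n ω, X n ω ≤ 0) (hsub : IsSubadditiveOver μ T X) :
    ∀ᵐ ω ∂μ, Tendsto (fun n : ℕ => X n ω / n) atTop
      (𝓝 (limsup (fun n : ℕ => X n ω / n) atTop)) := by
  have hdiv : ∀ ω n, |X n ω / n| ≤ C := fun ω n => abs_div_natCast_le hC (hXC n ω)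
  have hXi : ∀ n, 1 ≤ n → Integrable (X n) μ := fun n _ =>
    .of_bound (hX n).aestronglyMeasurable (C * n) (.of_forall (hXC n))
  obtain ⟨L, hL, hLle⟩ := exists_tendsto_div_of_subadditive (u := fun n => ∫ ω, X n ω ∂μ)
    (hsub.integral_add_le hT hXi) (c := -C) fun n hn => by
      have hpos : (0 : ℝ) < n := by exact_mod_cast hn
      have := integral_mono (integrable_const (-(C * n))) (hXi n hn)
        fun ω => (abs_le.1 (hXC n ω)).1
      rw [le_div_iff₀ hpos]
      simp at this
      linarith
  have h1 := le_integral_liminf_of_bounded hT hX hC hXC hsub hLle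
  have h2 := ge_of_tendsto hL ((eventually_ge_atTop 1).mono fun k hk =>
    integral_limsup_le_of_bounded hT hX hC hXC hneg hsub hk)
  have hle : ∀ ω, liminf (fun n : ℕ => X n ω / n) atTop ≤ limsup (fun n : ℕ => X n ω / n) atTop :=
    fun ω => liminf_le_limsup (isBoundedUnder_le_of_abs_le (hdiv ω))
      (isBoundedUnder_ge_of_abs_le (hdiv ω))
  have hsup : Integrable (fun ω => limsup (fun n : ℕ => X n ω / n) atTop) μ :=
    .of_bound (Measurable.limsup fun n => (hX n).div_const _).aestronglyMeasurable C
      (.of_forall fun ω => abs_limsup_le (hdiv ω))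
  have hinf : Integrable (fun ω => liminf (fun n : ℕ => X n ω / n) atTop) μ :=
    .of_bound (Measurable.liminf fun n => (hX n).div_const _).aestronglyMeasurable C
      (.of_forall fun ω => abs_liminf_le (hdiv ω))
  have heq := (integral_eq_iff_of_ae_le hinf hsup (.of_forall hle)).1
    (le_antisymm (integral_mono hinf hsup hle) (h2.trans h1))
  filter_upwards [heq] with ω hω
  exact tendsto_of_liminf_eq_limsup hω rfl (isBoundedUnder_le_of_abs_le (hdiv ω))
    (isBoundedUnder_ge_of_abs_le (hdiv ω))

/-- Scheffé's lemma for nonnegative real functions. -/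
theorem tendsto_integral_abs_sub_of_nonneg {f : ℕ → Ω → ℝ} {g : Ω → ℝ}
    (hf : ∀ n, Integrable (f n) μ) (hg : Integrable g μ) (hf0 : ∀ n, ∀ᵐ ω ∂μ, 0 ≤ f n ω)
    (hlim : ∀ᵐ ω ∂μ, Tendsto (fun n => f n ω) atTop (𝓝 (g ω)))
    (hint : Tendsto (fun n => ∫ ω, f n ω ∂μ) atTop (𝓝 (∫ ω, g ω ∂μ))) :
    Tendsto (fun n => ∫ ω, |f n ω - g ω| ∂μ) atTop (𝓝 0) := by
  have hpos : ∀ n, Integrable (fun ω => max (g ω - f n ω) 0) μ := fun n => (hg.sub (hf n)).pos_part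
  have h1 : Tendsto (fun n => ∫ ω, max (g ω - f n ω) 0 ∂μ) atTop (𝓝 (∫ _, (0 : ℝ) ∂μ)) := by
    refine tendsto_integral_of_dominated_convergence (fun ω => |g ω|)
      (fun n => (hpos n).aestronglyMeasurable) hg.abs (fun n => ?_) ?_
    · filter_upwards [hf0 n] with ω hω
      rw [Real.norm_of_nonneg (le_max_right _ _)]
      exact max_le (by linarith [le_abs_self (g ω)]) (abs_nonneg _)
    · filter_upwards [hlim] with ω hω
      simpa using (hω.const_sub (g ω)).max (tendsto_const_nhds (x := (0 : ℝ)))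
  have h2 := (hint.sub_const (∫ ω, g ω ∂μ)).add (h1.const_mul 2)
  simp only [integral_zero, sub_self, mul_zero, add_zero] at h2
  refine h2.congr fun n => ?_
  have hd : Integrable (fun ω => f n ω - g ω) μ := (hf n).sub hg
  rw [← integral_sub (hf n) hg, ← integral_const_mul, ← integral_add hd ((hpos n).const_mul 2)]
  refine integral_congr_ae (.of_forall fun ω => ?_)
  simp only
  rcases le_total (f n ω) (g ω) with h | h
  · rw [max_eq_left (by linarith), abs_of_nonpos (by linarith)]; ring
  · rw [max_eq_right (by linarith), abs_of_nonneg (by linarith)]; ring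

/-- `X n / n` converges to the integrable function `Y` almost everywhere and in `L¹`. -/
structure HasErgodicLimit (μ : Measure Ω) (X : ℕ → Ω → ℝ) (Y : Ω → ℝ) : Prop where
  integrable : Integrable Y μ
  ae_tendsto : ∀ᵐ ω ∂μ, Tendsto (fun n : ℕ => X n ω / n) atTop (𝓝 (Y ω))
  tendsto_integral_abs : Tendsto (fun n : ℕ => ∫ ω, |X n ω / n - Y ω| ∂μ) atTop (𝓝 0)

namespace HasErgodicLimit

variable {X X' : ℕ → Ω → ℝ} {Y Y' : Ω → ℝ}

theorem congr (h : HasErgodicLimit μ X Y) (hX : ∀ n, 1 ≤ n → X n =ᵐ[μ] X' n) :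
    HasErgodicLimit μ X' Y where
  integrable := h.integrable
  ae_tendsto := by
    have hae : ∀ᵐ ω ∂μ, ∀ n, 1 ≤ n → X n ω = X' n ω :=
      ae_all_iff.2 fun n => eventually_imp_distrib_left.2 (hX n)
    filter_upwards [h.ae_tendsto, hae] with ω hω hω'
    refine hω.congr' ?_
    filter_upwards [eventually_ge_atTop 1] with n hn
    rw [hω' n hn]
  tendsto_integral_abs := by
    refine h.tendsto_integral_abs.congr' ?_
    filter_upwards [eventually_ge_atTop 1] with n hn
    refine integral_congr_ae ?_
    filter_upwards [hX n hn] with ω hω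
    rw [hω]

theorem neg (h : HasErgodicLimit μ X Y) :
    HasErgodicLimit μ (fun n ω => -X n ω) (fun ω => -Y ω) where
  integrable := h.integrable.neg
  ae_tendsto := by
    filter_upwards [h.ae_tendsto] with ω hω
    simpa only [neg_div] using hω.neg
  tendsto_integral_abs := by
    refine h.tendsto_integral_abs.congr fun n => integral_congr_ae (.of_forall fun ω => ?_)
    simp only
    rw [← abs_neg]
    congr 1
    ring

theorem add (h : HasErgodicLimit μ X Y) (h' : HasErgodicLimit μ X' Y')
    (hX : ∀ n, 1 ≤ n → Integrable (X n) μ) (hX' : ∀ n, 1 ≤ n → Integrable (X' n) μ) :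
    HasErgodicLimit μ (fun n ω => X n ω + X' n ω) (fun ω => Y ω + Y' ω) where
  integrable := h.integrable.add h'.integrable
  ae_tendsto := by
    filter_upwards [h.ae_tendsto, h'.ae_tendsto] with ω hω hω'
    simpa only [add_div] using hω.add hω'
  tendsto_integral_abs := by
    refine squeeze_zero' (.of_forall fun n => integral_nonneg fun ω => abs_nonneg _) ?_
      (by simpa using h.tendsto_integral_abs.add h'.tendsto_integral_abs)
    filter_upwards [eventually_ge_atTop 1] with n hn
    have h1 := (((hX n hn).div_const n).sub h.integrable).abs
    have h2 := (((hX' n hn).div_const n).sub h'.integrable).abs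
    simp only [Pi.sub_apply] at h1 h2
    rw [← integral_add h1 h2]
    refine integral_mono_of_nonneg (.of_forall fun ω => abs_nonneg _) (h1.add h2)
      (.of_forall fun ω => ?_)
    have : (X n ω + X' n ω) / n - (Y ω + Y' ω) = (X n ω / n - Y ω) + (X' n ω / n - Y' ω) := by
      ring
    simp only [this]
    exact abs_add_le _ _

theorem tendsto_integral (h : HasErgodicLimit μ X Y) (hX : ∀ n, 1 ≤ n → Integrable (X n) μ) :
    Tendsto (fun n : ℕ => (∫ ω, X n ω ∂μ) / n) atTop (𝓝 (∫ ω, Y ω ∂μ)) := by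
  rw [tendsto_iff_norm_sub_tendsto_zero]
  refine squeeze_zero' (.of_forall fun n => norm_nonneg _) ?_ h.tendsto_integral_abs
  filter_upwards [eventually_ge_atTop 1] with n hn
  rw [← integral_div, ← integral_sub ((hX n hn).div_const _) h.integrable]
  exact norm_integral_le_integral_norm _

theorem ae_comp_eq (h : HasErgodicLimit μ X Y) (hT : MeasurePreserving T μ μ)
    (hsub : IsSubadditiveOver μ T X) : ∀ᵐ ω ∂μ, Y (T ω) = Y ω := by
  refine hT.ae_eq_comp_of_ae_le_comp h.integrable ?_
  have hae : ∀ᵐ ω ∂μ, ∀ n, 1 ≤ n → X (1 + n) ω ≤ X 1 ω + X n (T ω) :=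
    ae_all_iff.2 fun n => eventually_imp_distrib_left.2 fun hn => hsub 1 n le_rfl hn
  filter_upwards [hae, h.ae_tendsto, hT.quasiMeasurePreserving.ae h.ae_tendsto] with ω h1 h2 h3
  have h4 : Tendsto (fun n : ℕ => X (n + 1) ω / (n + 1 : ℕ) * ((n + 1 : ℕ) / n)) atTop
      (𝓝 (Y ω * 1)) := by
    refine (h2.comp (tendsto_add_atTop_nat 1)).mul ?_
    have : Tendsto (fun n : ℕ => 1 + (1 : ℝ) / n) atTop (𝓝 1) := by
      simpa using tendsto_const_nhds.add (tendsto_const_div_atTop_nhds_zero_nat (1 : ℝ))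
    refine this.congr' ?_
    filter_upwards [eventually_ge_atTop 1] with n hn
    have hpos : (0 : ℝ) < n := by exact_mod_cast hn
    push_cast
    field_simp
  have h5 : Tendsto (fun n : ℕ => X 1 ω / n + X n (T ω) / n) atTop (𝓝 (0 + Y (T ω))) :=
    (tendsto_const_div_atTop_nhds_zero_nat _).add h3
  rw [mul_one] at h4
  rw [zero_add] at h5
  refine le_of_tendsto_of_tendsto h4 h5 ?_
  filter_upwards [eventually_ge_atTop 1] with n hn
  have hpos : (0 : ℝ) < n := by exact_mod_cast hn
  have hpos' : ((n + 1 : ℕ) : ℝ) ≠ 0 := by positivity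
  rw [← mul_div_assoc, div_mul_cancel₀ _ hpos', ← add_div]
  have := h1 n hn
  rw [add_comm] at this
  gcongr

end HasErgodicLimit

theorem exists_tendsto_of_forall_exists_tendsto_max {x : ℕ → ℝ}
    (hx : liminf (fun n => ‖x n‖ₑ) atTop < ⊤)
    (h : ∀ M : ℕ, ∃ l, Tendsto (fun n => max (x n) (-M)) atTop (𝓝 l)) :
    ∃ l, Tendsto x atTop (𝓝 l) := by
  obtain ⟨R, hR, -⟩ := ENNReal.lt_iff_exists_nnreal_btwn.1 hx
  have hfr : ∃ᶠ n in atTop, ‖x n‖ₑ < R := frequently_lt_of_liminf_lt (by isBoundedDefault) hR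
  obtain ⟨M, hM⟩ := exists_nat_gt (R : ℝ)
  obtain ⟨l, hl⟩ := h M
  have hlR : (-R : ℝ) ≤ l := by
    refine ge_of_tendsto_of_frequently hl (hfr.mono fun n hn => ?_)
    have h1 : ‖x n‖ < R := by
      rwa [← ofReal_norm, ENNReal.ofReal_lt_coe_iff (norm_nonneg _)] at hn
    exact (abs_lt.1 h1).1.le.trans (le_max_left _ _)
  refine ⟨l, hl.congr' ?_⟩
  filter_upwards [hl.eventually (lt_mem_nhds (show (-M : ℝ) < l by linarith))] with n hn
  exact max_eq_left ((lt_max_iff.1 hn).resolve_right (lt_irrefl _)).le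

theorem exists_hasErgodicLimit_of_nonpos_of_measurable [IsProbabilityMeasure μ]
    (hT : MeasurePreserving T μ μ) {X : ℕ → Ω → ℝ} (hX : ∀ n, Measurable (X n))
    (hneg : ∀ n ω, X n ω ≤ 0) (hXi : ∀ n, 1 ≤ n → Integrable (X n) μ)
    (hsub : IsSubadditiveOver μ T X) {c : ℝ} (hc : ∀ n : ℕ, 1 ≤ n → c ≤ (∫ ω, X n ω ∂μ) / n) :
    ∃ Y, HasErgodicLimit μ X Y := by
  obtain ⟨L, hL, hLle⟩ := exists_tendsto_div_of_subadditive (u := fun n => ∫ ω, X n ω ∂μ)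
    (hsub.integral_add_le hT hXi) hc
  have hdivm : ∀ n : ℕ, Measurable fun ω => X n ω / n := fun n => (hX n).div_const _
  have hdivneg : ∀ (n : ℕ) ω, X n ω / n ≤ 0 := fun n ω =>
    div_nonpos_of_nonpos_of_nonneg (hneg n ω) n.cast_nonneg
  have hdivi : ∀ n : ℕ, Integrable (fun ω => X n ω / n) μ := fun n => by
    rcases Nat.eq_zero_or_pos n with rfl | hn
    · simp
    · exact (hXi n hn).div_const _
  have hlint : ∀ n : ℕ, ∫⁻ ω, ‖X n ω / n‖ₑ ∂μ = ENNReal.ofReal (-((∫ ω, X n ω ∂μ) / n)) :=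
    fun n => by
      rw [← ofReal_integral_norm_eq_lintegral_enorm (hdivi n), ← integral_div, ← integral_neg]
      congr 1
      exact integral_congr_ae (.of_forall fun ω => Real.norm_of_nonpos (hdivneg n ω))
  let Z : ℕ → ℕ → Ω → ℝ := fun M n ω => max (X n ω) (-(M * n))
  have hZm : ∀ M n, Measurable (Z M n) := fun M n => (hX n).max measurable_const
  have hZneg : ∀ M n ω, Z M n ω ≤ 0 := fun M n ω => max_le (hneg n ω) (by simp; positivity)
  have hZM : ∀ M n ω, |Z M n ω| ≤ M * n := fun M n ω => by
    rw [abs_of_nonpos (hZneg M n ω), neg_le]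
    exact le_max_right _ _
  have hZsub : ∀ M, IsSubadditiveOver μ T (Z M) := fun M m n hm hn => by
    filter_upwards [hsub m n hm hn] with ω hω
    refine max_le (hω.trans (add_le_add (le_max_left _ _) (le_max_left _ _))) ?_
    refine le_trans (le_of_eq ?_) (add_le_add (le_max_right _ _) (le_max_right _ _))
    push_cast
    ring
  have hZdiv : ∀ M n ω, 1 ≤ n → Z M n ω / n = max (X n ω / n) (-M) := fun M n ω hn => by
    have hpos : (0 : ℝ) < n := by exact_mod_cast hn
    rw [← max_div_div_right hpos.le, neg_div, mul_div_cancel_right₀ _ hpos.ne']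
  have hZlim : ∀ᵐ ω ∂μ, ∀ M : ℕ, Tendsto (fun n : ℕ => max (X n ω / n) (-M)) atTop
      (𝓝 (limsup (fun n : ℕ => Z M n ω / n) atTop)) := by
    refine ae_all_iff.2 fun M => ?_
    filter_upwards [ae_tendsto_limsup_of_bounded hT (hZm M) M.cast_nonneg (hZM M) (hZneg M)
      (hZsub M)] with ω hω
    refine hω.congr' ?_
    filter_upwards [eventually_ge_atTop 1] with n hn using hZdiv M n ω hn
  have hbdd : ∀ᵐ ω ∂μ, liminf (fun n : ℕ => ‖X n ω / n‖ₑ) atTop < ⊤ := by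
    refine ae_bdd_liminf_atTop_of_eLpNorm_bdd (p := 1) (R := (-c).toNNReal) one_ne_zero hdivm
      fun n => ?_
    rw [eLpNorm_one_eq_lintegral_enorm, hlint, ENNReal.ofReal]
    rcases Nat.eq_zero_or_pos n with rfl | hn
    · simp
    · exact ENNReal.coe_le_coe.2 (Real.toNNReal_le_toNNReal (neg_le_neg (hc n hn)))
  have hYlim : ∀ᵐ ω ∂μ, Tendsto (fun n : ℕ => X n ω / n) atTop
      (𝓝 (limUnder atTop fun n : ℕ => X n ω / n)) := by
    filter_upwards [hZlim, hbdd] with ω h1 h2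
    exact tendsto_nhds_limUnder
      (exists_tendsto_of_forall_exists_tendsto_max h2 fun M => ⟨_, h1 M⟩)
  set Y : Ω → ℝ := fun ω => limUnder atTop fun n : ℕ => X n ω / n with hY
  have hYm : AEStronglyMeasurable Y μ :=
    aestronglyMeasurable_of_tendsto_ae atTop (fun n => (hdivm n).aestronglyMeasurable) hYlim
  have hfatou : ∫⁻ ω, ‖Y ω‖ₑ ∂μ ≤ ENNReal.ofReal (-L) := by
    have h1 : Tendsto (fun n : ℕ => ∫⁻ ω, ‖X n ω / n‖ₑ ∂μ) atTop (𝓝 (ENNReal.ofReal (-L))) := by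
      simp only [hlint]
      exact ENNReal.tendsto_ofReal hL.neg
    rw [← h1.liminf_eq]
    refine le_trans (le_of_eq (lintegral_congr_ae ?_))
      (lintegral_liminf_le fun n => (hdivm n).enorm)
    filter_upwards [hYlim] with ω hω using hω.enorm.liminf_eq.symm
  have hYi : Integrable Y μ := ⟨hYm, hfatou.trans_lt ENNReal.ofReal_lt_top⟩
  have hYneg : ∀ᵐ ω ∂μ, Y ω ≤ 0 := by
    filter_upwards [hYlim] with ω hω using le_of_tendsto' hω fun n => hdivneg n ω
  have hLneg : L ≤ 0 := le_of_tendsto' hL fun n =>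
    div_nonpos_of_nonpos_of_nonneg (integral_nonpos (hneg n)) n.cast_nonneg
  have hlow : L ≤ ∫ ω, Y ω ∂μ := by
    rw [← ofReal_integral_norm_eq_lintegral_enorm hYi,
      ENNReal.ofReal_le_ofReal_iff (by linarith)] at hfatou
    have : ∫ ω, ‖Y ω‖ ∂μ = -∫ ω, Y ω ∂μ := by
      rw [← integral_neg]
      refine integral_congr_ae ?_
      filter_upwards [hYneg] with ω hω using Real.norm_of_nonpos hω
    linarith
  have hup : ∀ k, 1 ≤ k → ∫ ω, Y ω ∂μ ≤ (∫ ω, X k ω ∂μ) / k := by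
    intro k hk
    have h1 : Tendsto (fun M : ℕ => ∫ ω, Z M k ω ∂μ) atTop (𝓝 (∫ ω, X k ω ∂μ)) := by
      refine tendsto_integral_of_dominated_convergence (fun ω => |X k ω|)
        (fun M => (hZm M k).aestronglyMeasurable) (hXi k hk).abs (fun M => .of_forall fun ω => ?_)
        (.of_forall fun ω => ?_)
      · rw [Real.norm_of_nonpos (hZneg M k ω), abs_of_nonpos (hneg k ω)]
        exact neg_le_neg (le_max_left _ _)
      · obtain ⟨N, hN⟩ := exists_nat_ge (-X k ω)
        refine tendsto_const_nhds.congr' ?_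
        filter_upwards [eventually_ge_atTop N] with M hM
        have h2 : (N : ℝ) ≤ M := by exact_mod_cast hM
        have h3 : (1 : ℝ) ≤ k := by exact_mod_cast hk
        exact (max_eq_left (by nlinarith [M.cast_nonneg (α := ℝ)])).symm
    refine ge_of_tendsto' (h1.div_const (k : ℝ)) fun M => ?_
    refine le_trans ?_ (integral_limsup_le_of_bounded hT (hZm M) M.cast_nonneg (hZM M) (hZneg M)
      (hZsub M) hk)
    have hWi : Integrable (fun ω => limsup (fun n : ℕ => Z M n ω / n) atTop) μ :=
      .of_bound (Measurable.limsup fun n => (hZm M n).div_const _).aestronglyMeasurable M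
        (.of_forall fun ω => abs_limsup_le fun n => abs_div_natCast_le M.cast_nonneg (hZM M n ω))
    refine integral_mono_ae hYi hWi ?_
    filter_upwards [hYlim, hZlim] with ω h1 h2
    exact le_of_tendsto_of_tendsto' h1 (h2 M) fun n => le_max_left _ _
  have hYL : ∫ ω, Y ω ∂μ = L :=
    le_antisymm (ge_of_tendsto hL ((eventually_ge_atTop 1).mono hup)) hlow
  refine ⟨Y, hYi, hYlim, ?_⟩
  have h := tendsto_integral_abs_sub_of_nonneg (fun n => (hdivi n).neg) hYi.neg
    (fun n => .of_forall fun ω => neg_nonneg.2 (hdivneg n ω))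
    (hYlim.mono fun ω hω => hω.neg) (by
      simp only [Pi.neg_apply, integral_neg, integral_div, hYL]
      exact hL.neg)
  refine h.congr fun n => integral_congr_ae (.of_forall fun ω => ?_)
  simp only [Pi.neg_apply]
  rw [← abs_neg]
  congr 1
  ring

theorem exists_hasErgodicLimit_of_nonpos [IsProbabilityMeasure μ] (hT : MeasurePreserving T μ μ)
    {X : ℕ → Ω → ℝ} (hneg : ∀ n, 1 ≤ n → ∀ᵐ ω ∂μ, X n ω ≤ 0)
    (hXi : ∀ n, 1 ≤ n → Integrable (X n) μ) (hsub : IsSubadditiveOver μ T X) {c : ℝ}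
    (hc : ∀ n : ℕ, 1 ≤ n → c ≤ (∫ ω, X n ω ∂μ) / n) :
    ∃ Y, HasErgodicLimit μ X Y := by
  have hex : ∀ n, ∃ f : Ω → ℝ, Measurable f ∧ (∀ ω, f ω ≤ 0) ∧ (1 ≤ n → X n =ᵐ[μ] f) := fun n => by
    by_cases hn : 1 ≤ n
    · have hm := (hXi n hn).aestronglyMeasurable
      refine ⟨fun ω => min (hm.mk _ ω) 0, hm.stronglyMeasurable_mk.measurable.min measurable_const,
        fun ω => min_le_right _ _, fun _ => ?_⟩
      filter_upwards [hm.ae_eq_mk, hneg n hn] with ω h1 h2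
      rw [← h1, min_eq_left h2]
    · exact ⟨fun _ => 0, measurable_const, fun _ => le_rfl, fun h => absurd h hn⟩
  choose X' hm hneg' heq using hex
  obtain ⟨Y, hY⟩ := exists_hasErgodicLimit_of_nonpos_of_measurable (X := X') (c := c) hT hm hneg'
    (fun n hn => (hXi n hn).congr (heq n hn))
    (fun m n hm hn => by
      filter_upwards [hsub m n hm hn, heq m hm, heq (m + n) (by omega),
        (hT.iterate m).quasiMeasurePreserving.ae (heq n hn)] with ω h1 h2 h3 h4
      rwa [← h2, ← h3, ← h4])
    (fun n hn => by rw [← integral_congr_ae (heq n hn)]; exact hc n hn)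
  exact ⟨Y, hY.congr fun n hn => (heq n hn).symm⟩

theorem exists_hasErgodicLimit_birkhoffSum_of_nonpos [IsProbabilityMeasure μ]
    (hT : MeasurePreserving T μ μ) {f : Ω → ℝ} (hf : Integrable f μ) (hneg : ∀ ω, f ω ≤ 0) :
    ∃ Y, HasErgodicLimit μ (birkhoffSum T f) Y := by
  refine exists_hasErgodicLimit_of_nonpos (c := ∫ ω, f ω ∂μ) hT
    (fun n _ => .of_forall fun ω => Finset.sum_nonpos fun i _ => hneg _)
    (fun n _ => hT.integrable_birkhoffSum hf n)
    (fun m n _ _ => .of_forall fun ω => (birkhoffSum_add T f m n ω).le) fun n hn => ?_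
  have hpos : (0 : ℝ) < n := by exact_mod_cast hn
  rw [hT.integral_birkhoffSum hf, mul_div_cancel_left₀ _ hpos.ne']

/-- **Birkhoff's ergodic theorem**, without the identification of the limit. -/
theorem exists_hasErgodicLimit_birkhoffSum [IsProbabilityMeasure μ]
    (hT : MeasurePreserving T μ μ) {f : Ω → ℝ} (hf : Integrable f μ) :
    ∃ Y, HasErgodicLimit μ (birkhoffSum T f) Y := by
  have hp : Integrable (fun ω => -max (f ω) 0) μ := hf.pos_part.neg
  have hn : Integrable (fun ω => -max (-f ω) 0) μ := hf.neg_part.neg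
  obtain ⟨Y, hY⟩ := exists_hasErgodicLimit_birkhoffSum_of_nonpos hT hp fun ω =>
    neg_nonpos.2 (le_max_right _ _)
  obtain ⟨Z, hZ⟩ := exists_hasErgodicLimit_birkhoffSum_of_nonpos hT hn fun ω =>
    neg_nonpos.2 (le_max_right _ _)
  refine ⟨_, (hY.neg.add hZ (fun n _ => (hT.integrable_birkhoffSum hp n).neg)
    fun n _ => hT.integrable_birkhoffSum hn n).congr fun n _ => .of_forall fun ω => ?_⟩
  simp only [birkhoffSum, ← Finset.sum_neg_distrib, ← Finset.sum_add_distrib]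
  refine Finset.sum_congr rfl fun i _ => ?_
  rw [neg_neg, ← sub_eq_add_neg]
  exact max_zero_sub_max_neg_zero_eq_self (f (T^[i] ω))

theorem IsSubadditiveOver.ae_le_birkhoffSum {X : ℕ → Ω → ℝ} (hsub : IsSubadditiveOver μ T X)
    (n : ℕ) (hn : 1 ≤ n) : ∀ᵐ ω ∂μ, X n ω ≤ birkhoffSum T (X 1) n ω := by
  induction n, hn using Nat.le_induction with
  | base => simp
  | succ n hn ih =>
    filter_upwards [ih, hsub n 1 hn le_rfl] with ω h1 h2
    rw [birkhoffSum_succ]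
    linarith

theorem exists_hasErgodicLimit [IsProbabilityMeasure μ] (hT : MeasurePreserving T μ μ)
    {X : ℕ → Ω → ℝ} (hXi : ∀ n, 1 ≤ n → Integrable (X n) μ) (hsub : IsSubadditiveOver μ T X)
    {c : ℝ} (hc : ∀ n : ℕ, 1 ≤ n → c ≤ (∫ ω, X n ω ∂μ) / n) :
    ∃ Y, HasErgodicLimit μ X Y := by
  have h1 := hXi 1 le_rfl
  have hSi := hT.integrable_birkhoffSum h1
  have hdi : ∀ n, 1 ≤ n → Integrable (fun ω => X n ω - birkhoffSum T (X 1) n ω) μ :=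
    fun n hn => (hXi n hn).sub (hSi n)
  obtain ⟨Y, hY⟩ := exists_hasErgodicLimit_birkhoffSum hT h1
  obtain ⟨Z, hZ⟩ := exists_hasErgodicLimit_of_nonpos
    (X := fun n ω => X n ω - birkhoffSum T (X 1) n ω) (c := c - ∫ ω, X 1 ω ∂μ) hT
    (fun n hn => (hsub.ae_le_birkhoffSum n hn).mono fun ω hω => sub_nonpos.2 hω) hdi
    (fun m n hm hn => (hsub m n hm hn).mono fun ω hω => by
      simp only [birkhoffSum_add]
      linarith)
    (fun n hn => by
      have hpos : (0 : ℝ) < n := by exact_mod_cast hn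
      rw [integral_sub (hXi n hn) (hSi n), hT.integral_birkhoffSum h1, sub_div,
        mul_div_cancel_left₀ _ hpos.ne']
      linarith [hc n hn])
  exact ⟨_, (hY.add hZ (fun n _ => hSi n) hdi).congr fun n _ => .of_forall fun ω => by simp⟩

end

/-- **Subadditive ergodic theorem** (Kingman's form of the Hammersley–Welsh theorem).
Let `(Ω, F, μ)` be a probability space, `T` a measure-preserving map, and `(X_n)_{n ≥ 1}`
integrable random variables with `X_{m+n} ≤ X_m + X_n ∘ T^m` a.e. for all `m, n ≥ 1` and
`inf_{n ≥ 1} E[X_n]/n > -∞`.  Then `X_n / n` converges a.e. and in `L¹` to an integrable,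
`T`-invariant random variable `Y`, and `E[Y] = lim_n E[X_n]/n = inf_{n ≥ 1} E[X_n]/n`. -/
theorem subadditive_ergodic_theorem
    {Ω : Type*} [MeasurableSpace Ω] (μ : Measure Ω) [IsProbabilityMeasure μ]
    (T : Ω → Ω) (hT : MeasurePreserving T μ μ)
    (X : ℕ → Ω → ℝ)
    (hint : ∀ n : ℕ, 1 ≤ n → Integrable (X n) μ)
    (hsub : ∀ m n : ℕ, 1 ≤ m → 1 ≤ n →
      ∀ᵐ ω ∂μ, X (m + n) ω ≤ X m ω + X n (T^[m] ω))
    (hbdd : ∃ c : ℝ, ∀ n : ℕ, 1 ≤ n → c ≤ (∫ ω, X n ω ∂μ) / n) :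
    ∃ Y : Ω → ℝ, Integrable Y μ ∧
      (∀ᵐ ω ∂μ, Y (T ω) = Y ω) ∧
      (∀ᵐ ω ∂μ, Tendsto (fun n : ℕ => X n ω / n) atTop (𝓝 (Y ω))) ∧
      Tendsto (fun n : ℕ => ∫ ω, |X n ω / n - Y ω| ∂μ) atTop (𝓝 0) ∧
      Tendsto (fun n : ℕ => (∫ ω, X n ω ∂μ) / n) atTop (𝓝 (∫ ω, Y ω ∂μ)) ∧
      (∫ ω, Y ω ∂μ) = ⨅ n : {n : ℕ // 1 ≤ n}, (∫ ω, X n.val ω ∂μ) / (n.val : ℝ) := by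
  obtain ⟨c, hc⟩ := hbdd
  obtain ⟨Y, hY⟩ := exists_hasErgodicLimit hT hint hsub hc
  have hlim := hY.tendsto_integral hint
  obtain ⟨L, hL, hLle⟩ := exists_tendsto_div_of_subadditive (u := fun n => ∫ ω, X n ω ∂μ)
    (IsSubadditiveOver.integral_add_le hT hint hsub) hc
  have hYL : ∫ ω, Y ω ∂μ = L := tendsto_nhds_unique hlim hL
  refine ⟨Y, hY.integrable, hY.ae_comp_eq hT hsub, hY.ae_tendsto, hY.tendsto_integral_abs, hlim, ?_⟩
  rw [hYL]
  have : Nonempty {n : ℕ // 1 ≤ n} := ⟨⟨1, le_rfl⟩⟩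
  refine le_antisymm (le_ciInf fun n => hLle n.1 n.2) (ge_of_tendsto hL ?_)
  filter_upwards [eventually_ge_atTop 1] with n hn
  exact ciInf_le (f := fun n : {n : ℕ // 1 ≤ n} => (∫ ω, X n.val ω ∂μ) / (n.val : ℝ))
    ⟨c, by rintro _ ⟨n, rfl⟩; exact hc n.1 n.2⟩ ⟨n, hn⟩
end
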